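/- Let s = 1/2, let σ(t) be the unique solution in (0, e^{−1/2}) of σ² log(1/σ) = t, and define b_N(t) = ( ∫_{B^{N-1}_{1/σ(t)}} |y'|² P_{1/2}((y',0)) dy' ) / ( 2 log(1/σ(t)) ∫_{ℝ^{N-1}} P_{1/2}((y',0)) dy' ). Then there exist constants C > 0 and t₀ > 0 such that for all t ∈ (0, t₀) and all v ∈ ℝ satisfying |v t| ≤ σ(t) and u(v t e_N, σ(t)) = 0, one has |v − b_N(t) H(0)| ≤ C / log(1/σ(t)). -/

import Mathlib

open MeasureTheory Metric Real Set

noncomputable section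

/-- Append a last coordinate: `(y', a) ∈ ℝ^{N-1} × ℝ ↦ ℝ^N`. -/
def snocPt {d : ℕ} (y' : EuclideanSpace ℝ (Fin d)) (a : ℝ) :
    EuclideanSpace ℝ (Fin (d + 1)) :=
  (EuclideanSpace.equiv (Fin (d + 1)) ℝ).symm
    (Fin.snoc ((EuclideanSpace.equiv (Fin d) ℝ) y') a)

/-- The last standard basis vector `e_N` of `ℝ^N`. -/
def eN (d : ℕ) : EuclideanSpace ℝ (Fin (d + 1)) :=
  EuclideanSpace.single (Fin.last d) 1

/-- `τ_E = 𝟙_E − 𝟙_{ℝ^N ∖ cl E}`. -/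
def tauE {d : ℕ} (E : Set (EuclideanSpace ℝ (Fin (d + 1))))
    (y : EuclideanSpace ℝ (Fin (d + 1))) : ℝ :=
  Set.indicator E (fun _ => 1) y - Set.indicator (closure E)ᶜ (fun _ => 1) y

/-- The kernel `𝒦_{1/2}(x,t) = t^{-N} P(t^{-1} x)` with `N = d+1`. -/
def ker12 {d : ℕ} (P : EuclideanSpace ℝ (Fin (d + 1)) → ℝ)
    (x : EuclideanSpace ℝ (Fin (d + 1))) (t : ℝ) : ℝ :=
  t ^ (-(((d : ℝ) + 1))) * P ((t ^ (-(1 : ℝ))) • x)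

/-- `u(x,t) = ∫_{ℝ^N} 𝒦_{1/2}(x−y,t) τ_E(y) dy`. -/
def uF12 {d : ℕ} (P : EuclideanSpace ℝ (Fin (d + 1)) → ℝ)
    (E : Set (EuclideanSpace ℝ (Fin (d + 1)))) (x : EuclideanSpace ℝ (Fin (d + 1)))
    (t : ℝ) : ℝ :=
  ∫ y, ker12 P (x - y) t * tauE E y

/-- The Laplacian `Δγ(0) = ∑ᵢ ∂²γ/∂yᵢ²(0)`. -/
def lap0 {d : ℕ} (γ : EuclideanSpace ℝ (Fin d) → ℝ) : ℝ :=
  ∑ i : Fin d,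
    iteratedFDeriv ℝ 2 γ 0 ![EuclideanSpace.single i 1, EuclideanSpace.single i 1]

lemma snocPt_apply_last {d : ℕ} (y : EuclideanSpace ℝ (Fin d)) (a : ℝ) :
    snocPt y a (Fin.last d) = a := by
  simp [snocPt]

lemma snocPt_apply_castSucc {d : ℕ} (y : EuclideanSpace ℝ (Fin d)) (a : ℝ) (i : Fin d) :
    snocPt y a i.castSucc = y i := by
  simp [snocPt]

lemma norm_sq_snocPt {d : ℕ} (y : EuclideanSpace ℝ (Fin d)) (a : ℝ) :
    ‖snocPt y a‖ ^ 2 = ‖y‖ ^ 2 + a ^ 2 := by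
  simp [EuclideanSpace.norm_sq_eq, Fin.sum_univ_castSucc, snocPt_apply_last,
    snocPt_apply_castSucc]

lemma norm_snocPt_zero {d : ℕ} (y : EuclideanSpace ℝ (Fin d)) : ‖snocPt y 0‖ = ‖y‖ := by
  have h := norm_sq_snocPt y 0
  exact (pow_left_inj₀ (norm_nonneg _) (norm_nonneg _) two_ne_zero).1 (by simpa using h)

lemma norm_le_norm_snocPt {d : ℕ} (y : EuclideanSpace ℝ (Fin d)) (a : ℝ) :
    ‖y‖ ≤ ‖snocPt y a‖ :=
  (sq_le_sq₀ (norm_nonneg _) (norm_nonneg _)).1 (by rw [norm_sq_snocPt]; nlinarith [sq_nonneg a])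

lemma abs_le_norm_snocPt {d : ℕ} (y : EuclideanSpace ℝ (Fin d)) (a : ℝ) :
    |a| ≤ ‖snocPt y a‖ :=
  (sq_le_sq₀ (abs_nonneg _) (norm_nonneg _)).1
    (by rw [norm_sq_snocPt, sq_abs]; nlinarith [sq_nonneg ‖y‖])

lemma eN_eq_snocPt (d : ℕ) : eN d = snocPt 0 1 := by
  ext i
  refine Fin.lastCases ?_ (fun j => ?_) i
  · simp [eN, snocPt_apply_last]
  · simp [eN, snocPt_apply_castSucc, (Fin.castSucc_lt_last j).ne]

lemma snocPt_add_smul {d : ℕ} (y z : EuclideanSpace ℝ (Fin d)) (a b c : ℝ) :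
    snocPt y a + c • snocPt z b = snocPt (y + c • z) (a + c * b) := by
  ext i
  refine Fin.lastCases ?_ (fun j => ?_) i
  · simp [snocPt_apply_last]
  · simp [snocPt_apply_castSucc]

/-- `ℝ^d × ℝ ≃ ℝ^(d+1)` through `snocPt`. -/
def snocMeasurableEquiv (d : ℕ) :
    EuclideanSpace ℝ (Fin d) × ℝ ≃ᵐ EuclideanSpace ℝ (Fin (d + 1)) :=
  (((MeasurableEquiv.toLp 2 (Fin d → ℝ)).symm.prodCongr (MeasurableEquiv.refl ℝ)).trans
    MeasurableEquiv.prodComm).trans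
    ((MeasurableEquiv.piFinSuccAbove (fun _ => ℝ) (Fin.last d)).symm.trans
      (MeasurableEquiv.toLp 2 (Fin (d + 1) → ℝ)))

lemma snocMeasurableEquiv_apply {d : ℕ} (q : EuclideanSpace ℝ (Fin d) × ℝ) :
    snocMeasurableEquiv d q = snocPt q.1 q.2 := by
  ext i
  refine Fin.lastCases ?_ (fun j => ?_) i
  · simp [snocMeasurableEquiv, snocPt_apply_last, MeasurableEquiv.prodComm,
      MeasurableEquiv.piFinSuccAbove]
    rfl
  · simp [snocMeasurableEquiv, snocPt_apply_castSucc, MeasurableEquiv.prodComm,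
      MeasurableEquiv.piFinSuccAbove]
    rfl

lemma measurePreserving_snocMeasurableEquiv (d : ℕ) :
    MeasurePreserving (snocMeasurableEquiv d) := by
  have h1 : MeasurePreserving (fun q : EuclideanSpace ℝ (Fin d) × ℝ => (WithLp.ofLp q.1, q.2)) :=
    (PiLp.volume_preserving_ofLp (Fin d)).prod (MeasurePreserving.id volume)
  exact (PiLp.volume_preserving_toLp (Fin (d + 1))).comp
    (((volume_preserving_piFinSuccAbove (fun _ => ℝ) (Fin.last d)).symm).comp
      (Measure.measurePreserving_swap.comp h1))

lemma continuous_snocPt (d : ℕ) :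
    Continuous (fun q : EuclideanSpace ℝ (Fin d) × ℝ => snocPt q.1 q.2) := by
  refine (EuclideanSpace.equiv (Fin (d + 1)) ℝ).symm.continuous.comp (continuous_pi fun i => ?_)
  refine Fin.lastCases ?_ (fun j => ?_) i
  · simpa using continuous_snd
  · simp only [Fin.snoc_castSucc]
    exact (EuclideanSpace.proj (𝕜 := ℝ) j).continuous.comp continuous_fst

lemma integral_eq_integral_snocPt {d : ℕ} (F : EuclideanSpace ℝ (Fin (d + 1)) → ℝ) :
    ∫ w, F w = ∫ q : EuclideanSpace ℝ (Fin d) × ℝ, F (snocPt q.1 q.2) := by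
  rw [← (measurePreserving_snocMeasurableEquiv d).integral_comp'
    (g := F)]
  simp_rw [snocMeasurableEquiv_apply]

lemma Integrable.comp_snocPt {d : ℕ} {F : EuclideanSpace ℝ (Fin (d + 1)) → ℝ}
    (hF : Integrable F) :
    Integrable (fun q : EuclideanSpace ℝ (Fin d) × ℝ => F (snocPt q.1 q.2)) := by
  have := ((measurePreserving_snocMeasurableEquiv d).integrable_comp_emb
    (snocMeasurableEquiv d).measurableEmbedding).2 hF
  simpa [Function.comp_def, snocMeasurableEquiv_apply] using this

lemma uF12_eq_integral {d : ℕ} (P : EuclideanSpace ℝ (Fin (d + 1)) → ℝ)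
    (E : Set (EuclideanSpace ℝ (Fin (d + 1)))) (x : EuclideanSpace ℝ (Fin (d + 1)))
    {s : ℝ} (hs : 0 < s) :
    uF12 P E x s = ∫ w, P w * tauE E (x - s • w) := by
  have h1 := integral_sub_left_eq_self (fun z => ker12 P z s * tauE E (x - z)) volume x
  have h2 := Measure.integral_comp_smul_of_nonneg (volume)
    (fun z => ker12 P z s * tauE E (x - z)) s (hR := hs.le)
  have h3 : uF12 P E x s = ∫ z, ker12 P z s * tauE E (x - z) := by
    rw [← h1]; simp [uF12]
  have hk : ∀ w, ker12 P (s • w) s = (s ^ (d + 1))⁻¹ * P w := by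
    intro w
    simp only [ker12, rpow_neg hs.le, rpow_one, smul_smul, inv_mul_cancel₀ hs.ne', one_smul]
    norm_cast
  simp only [hk, mul_assoc, integral_const_mul, finrank_euclideanSpace, Fintype.card_fin,
    smul_eq_mul] at h2
  rw [h3]
  exact (mul_left_cancel₀ (by positivity) h2).symm

section RadialIntegrals

variable {V : Type*} [NormedAddCommGroup V] [InnerProductSpace ℝ V] [FiniteDimensional ℝ V]
  [MeasurableSpace V] [BorelSpace V]

lemma integrable_inv_one_add_norm_pow {n : ℕ} (hn : Module.finrank ℝ V < n) :
    Integrable (fun x : V => 1 / (1 + ‖x‖ ^ n)) := by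
  have h := (integrable_one_add_norm (μ := (volume : Measure V)) (r := (n : ℝ))
    (by exact_mod_cast hn)).const_mul (2 ^ n)
  refine h.mono' (continuous_const.div (by fun_prop)
    fun x => by positivity).aestronglyMeasurable (Filter.Eventually.of_forall fun x => ?_)
  have hx := norm_nonneg x
  rw [rpow_neg (by positivity), rpow_natCast, ← div_eq_mul_inv, norm_of_nonneg (by positivity),
    div_le_div_iff₀ (by positivity) (by positivity), one_mul]
  rcases le_total ‖x‖ 1 with h1 | h1
  · calc (1 + ‖x‖) ^ n ≤ 2 ^ n := by gcongr; linarith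
      _ ≤ _ := le_mul_of_one_le_right (by positivity) (by linarith [pow_nonneg hx n])
  · calc (1 + ‖x‖) ^ n ≤ (2 * ‖x‖) ^ n := by gcongr; linarith
      _ = 2 ^ n * ‖x‖ ^ n := mul_pow _ _ _
      _ ≤ _ := by gcongr; linarith

/-- A radial integral over a ball is controlled by its one-dimensional majorant. -/
lemma setIntegral_ball_norm_le [Nontrivial V] {g h : ℝ → ℝ} {R : ℝ} (hR : 0 ≤ R)
    (hg : Continuous fun x : V => g ‖x‖)
    (hh : Continuous h)
    (hle : ∀ y, 0 < y → y < R → y ^ (Module.finrank ℝ V - 1) * g y ≤ h y) :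
    ∫ x in ball (0 : V) R, g ‖x‖ ≤
      Module.finrank ℝ V * volume.real (ball (0 : V) 1) * ∫ y in (0 : ℝ)..R, h y := by
  have e1 : ∫ x in ball (0 : V) R, g ‖x‖ = ∫ x : V, (Iio R).indicator g ‖x‖ := by
    rw [← integral_indicator measurableSet_ball]
    congr 1 with x
    simp [indicator]
  have hint : IntegrableOn (fun y : ℝ => y ^ (Module.finrank ℝ V - 1) • g y) (Ioo 0 R) := by
    rw [← integrableOn_fun_norm_addHaar (volume : Measure V)]
    exact (hg.continuousOn.integrableOn_compact (isCompact_closedBall 0 R)).mono_set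
      ball_subset_closedBall
  have e2 : ∫ y in Ioi (0 : ℝ), y ^ (Module.finrank ℝ V - 1) • (Iio R).indicator g y
      = ∫ y in Ioo (0 : ℝ) R, y ^ (Module.finrank ℝ V - 1) • g y := by
    rw [← Ioi_inter_Iio, ← setIntegral_indicator measurableSet_Iio]
    congr 1 with y
    by_cases hy : y < R <;> simp [hy, indicator]
  rw [e1, integral_fun_norm_addHaar, e2, intervalIntegral.integral_of_le hR,
    integral_Ioc_eq_integral_Ioo, nsmul_eq_mul, smul_eq_mul, mul_assoc]
  gcongr ?_ * (?_ * ?_)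
  refine setIntegral_mono_on hint ?_ measurableSet_Ioo fun y hy => hle y hy.1 hy.2
  exact (hh.integrableOn_Icc (a := 0) (b := R)).mono_set Ioo_subset_Icc_self

lemma exists_setIntegral_ball_le_mul [Nontrivial V] {k n : ℕ}
    (hkn : Module.finrank ℝ V - 1 + k ≤ n) :
    ∃ K > 0, ∀ R : ℝ, 0 < R → ∫ x in ball (0 : V) R, ‖x‖ ^ k / (1 + ‖x‖ ^ n) ≤ K * R := by
  refine ⟨Module.finrank ℝ V * volume.real (ball (0 : V) 1), ?_, fun R hR => ?_⟩
  · have : 0 < volume.real (ball (0 : V) 1) :=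
      ENNReal.toReal_pos (measure_ball_pos _ _ one_pos).ne' measure_ball_lt_top.ne
    have := Module.finrank_pos (R := ℝ) (M := V)
    positivity
  · have := setIntegral_ball_norm_le (V := V) (g := fun y => y ^ k / (1 + y ^ n))
      (h := fun _ => 1) hR.le ?_ continuous_const ?_
    · simpa using this
    · exact (by fun_prop : Continuous fun x : V => ‖x‖ ^ k).div (by fun_prop)
        fun x => by positivity
    · intro y hy _
      rw [← mul_div_assoc, ← pow_add, div_le_one (by positivity)]
      rcases le_total y 1 with h1 | h1
      · linarith [pow_le_one₀ (n := Module.finrank ℝ V - 1 + k) hy.le h1, pow_pos hy n]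
      · linarith [pow_le_pow_right₀ h1 hkn]

lemma exists_setIntegral_ball_le_log [Nontrivial V] {k n : ℕ}
    (hkn : Module.finrank ℝ V + k = n) :
    ∃ K > 0, ∀ R : ℝ, 0 < R →
      ∫ x in ball (0 : V) R, ‖x‖ ^ k / (1 + ‖x‖ ^ n) ≤ K * log (1 + R) := by
  have hpos := Module.finrank_pos (R := ℝ) (M := V)
  refine ⟨Module.finrank ℝ V * volume.real (ball (0 : V) 1) * 2, ?_, fun R hR => ?_⟩
  · have : 0 < volume.real (ball (0 : V) 1) :=
      ENNReal.toReal_pos (measure_ball_pos _ _ one_pos).ne' measure_ball_lt_top.ne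
    positivity
  · have := setIntegral_ball_norm_le (V := V) (g := fun y => y ^ k / (1 + y ^ n))
      (h := fun y => 2 * (1 + |y|)⁻¹) hR.le ?_ ?_ ?_
    · have hI : ∫ y in (0 : ℝ)..R, 2 * (1 + |y|)⁻¹ = 2 * log (1 + R) := by
        rw [intervalIntegral.integral_const_mul]
        congr 1
        have : ∫ y in (0 : ℝ)..R, (1 + |y|)⁻¹ = ∫ y in (0 : ℝ)..R, (1 + y)⁻¹ := by
          refine intervalIntegral.integral_congr fun y hy => ?_
          rw [uIcc_of_le hR.le] at hy
          simp [abs_of_nonneg hy.1]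
        rw [this, intervalIntegral.integral_comp_add_left (fun y => y⁻¹) 1,
          integral_inv_of_pos (by norm_num) (by linarith)]
        simp
      rw [hI] at this
      linarith
    · exact (by fun_prop : Continuous fun x : V => ‖x‖ ^ k).div (by fun_prop)
        fun x => by positivity
    · exact continuous_const.mul ((by fun_prop : Continuous fun y : ℝ => 1 + |y|).inv₀
        fun y => by positivity)
    · intro y hy _
      obtain ⟨j, rfl⟩ : ∃ j, n = j + 1 := ⟨n - 1, by omega⟩
      rw [← mul_div_assoc, ← pow_add, abs_of_pos hy, ← div_eq_mul_inv,
        div_le_div_iff₀ (by positivity) (by positivity),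
        show Module.finrank ℝ V - 1 + k = j by omega]
      have h3 : y ^ j ≤ 1 + y ^ (j + 1) := by
        rcases le_total y 1 with h1 | h1
        · linarith [pow_le_one₀ (n := j) hy.le h1, pow_pos hy (j + 1)]
        · linarith [pow_le_pow_right₀ h1 (by omega : j ≤ j + 1)]
      rw [mul_add, mul_one, ← pow_succ]
      linarith

lemma exists_setIntegral_compl_ball_le_div {k n : ℕ} (hkn : Module.finrank ℝ V + k < n) :
    ∃ K > 0, ∀ R : ℝ, 0 < R →
      ∫ x in (ball (0 : V) R)ᶜ, 1 / (1 + ‖x‖ ^ n) ≤ K / R ^ k := by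
  have hi : Integrable (fun x : V => ‖x‖ ^ k / (1 + ‖x‖ ^ n)) := by
    have h := (integrable_inv_one_add_norm_pow (V := V) (n := n - k) (by omega)).const_mul 2
    refine h.mono' ((by fun_prop : Continuous fun x : V => ‖x‖ ^ k).div (by fun_prop)
        fun x => by positivity).aestronglyMeasurable (Filter.Eventually.of_forall fun x => ?_)
    have hx := norm_nonneg x
    rw [norm_of_nonneg (by positivity), ← mul_div_assoc, mul_one,
      div_le_div_iff₀ (by positivity) (by positivity), mul_add, mul_one, ← pow_add,
      show k + (n - k) = n by omega]
    rcases le_total ‖x‖ 1 with h1 | h1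
    · linarith [pow_le_one₀ (n := k) hx h1, pow_nonneg hx n]
    · linarith [pow_le_pow_right₀ h1 (show k ≤ n by omega)]
  refine ⟨(∫ x : V, ‖x‖ ^ k / (1 + ‖x‖ ^ n)) + 1, ?_, fun R hR => ?_⟩
  · have : 0 ≤ ∫ x : V, ‖x‖ ^ k / (1 + ‖x‖ ^ n) := integral_nonneg fun x => by positivity
    linarith
  · rw [le_div_iff₀ (by positivity), ← integral_mul_const]
    refine le_trans ?_ (le_add_of_nonneg_right zero_le_one)
    refine le_trans (setIntegral_mono_on ?_ hi.integrableOn measurableSet_ball.compl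
      (g := fun x : V => ‖x‖ ^ k / (1 + ‖x‖ ^ n)) fun x hx => ?_)
      (setIntegral_le_integral hi (Filter.Eventually.of_forall fun x => by positivity))
    · exact ((integrable_inv_one_add_norm_pow (by omega)).mul_const _).integrableOn
    · have hx' : R ≤ ‖x‖ := by simpa using hx
      rw [div_mul_eq_mul_div, one_mul]
      gcongr

/-- The sharp decay of the tail of a radial integral. -/
lemma exists_setIntegral_compl_ball_le_inv [Nontrivial V] {n : ℕ}
    (hn : Module.finrank ℝ V + 1 = n) :
    ∃ K > 0, ∀ R : ℝ, 0 < R → ∫ x in (ball (0 : V) R)ᶜ, 1 / (1 + ‖x‖ ^ n) ≤ K / R := by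
  have hpos := Module.finrank_pos (R := ℝ) (M := V)
  have hball : 0 < volume.real (ball (0 : V) 1) :=
    ENNReal.toReal_pos (measure_ball_pos _ _ one_pos).ne' measure_ball_lt_top.ne
  refine ⟨Module.finrank ℝ V * volume.real (ball (0 : V) 1), by positivity, fun R hR => ?_⟩
  have e1 : ∫ x in (ball (0 : V) R)ᶜ, 1 / (1 + ‖x‖ ^ n)
      = ∫ x : V, (Ici R).indicator (fun y : ℝ => 1 / (1 + y ^ n)) ‖x‖ := by
    rw [← integral_indicator measurableSet_ball.compl]
    congr 1 with x
    simp [indicator]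
  have hI : IntegrableOn (fun y : ℝ => y ^ (-2 : ℝ)) (Ioi R) :=
    integrableOn_Ioi_rpow_of_lt (by norm_num) hR
  have e2 : ∫ y in Ioi (0 : ℝ), y ^ (Module.finrank ℝ V - 1) •
      (Ici R).indicator (fun y : ℝ => 1 / (1 + y ^ n)) y ≤ 1 / R := by
    have e3 : ∫ y in Ioi (0 : ℝ), y ^ (Module.finrank ℝ V - 1) •
        (Ici R).indicator (fun y : ℝ => 1 / (1 + y ^ n)) y
        = ∫ y in Ioi R, y ^ (Module.finrank ℝ V - 1) * (1 / (1 + y ^ n)) := by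
      rw [← integral_Ici_eq_integral_Ioi (x := R),
        ← inter_eq_self_of_subset_right (Ici_subset_Ioi.2 hR),
        ← setIntegral_indicator measurableSet_Ici]
      congr 1 with y
      by_cases hy : R ≤ y
      · simp [hy, indicator, hR.trans_le hy]
      · simp [hy, indicator]
    have e4 : ∫ y in Ioi R, y ^ (-2 : ℝ) = 1 / R := by
      rw [integral_Ioi_rpow_of_lt (by norm_num) hR]
      norm_num [rpow_neg_one]
    rw [e3, ← e4]
    refine integral_mono_of_nonneg ?_ hI ?_
    · filter_upwards [ae_restrict_mem measurableSet_Ioi] with y (hy : R < y)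
      have : 0 < y := hR.trans hy
      simp only [Pi.zero_apply]
      positivity
    · filter_upwards [ae_restrict_mem measurableSet_Ioi] with y (hy : R < y)
      have hy0 : 0 < y := hR.trans hy
      rw [rpow_neg hy0.le, ← one_div, ← mul_div_assoc, mul_one,
        div_le_div_iff₀ (by positivity) (by positivity)]
      norm_cast
      rw [← pow_add, show Module.finrank ℝ V - 1 + 2 = n by omega]
      linarith
  rw [e1, integral_fun_norm_addHaar, nsmul_eq_mul, smul_eq_mul, div_eq_mul_one_div, mul_assoc]
  gcongr

end RadialIntegrals

section SymmetricTensor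

variable {d : ℕ}

lemma integral_coord_mul_coord_mul_radial {f : EuclideanSpace ℝ (Fin d) → ℝ}
    (hf : ∀ x y, ‖x‖ = ‖y‖ → f x = f y) {i j : Fin d} (hij : i ≠ j) :
    ∫ x : EuclideanSpace ℝ (Fin d), x i * x j * f x = 0 := by
  let e : EuclideanSpace ℝ (Fin d) ≃ₗᵢ[ℝ] EuclideanSpace ℝ (Fin d) :=
    LinearIsometryEquiv.piLpCongrRight 2
      (fun k => if k = i then LinearIsometryEquiv.neg ℝ else LinearIsometryEquiv.refl ℝ ℝ)
  have he : ∀ x, e x i * e x j * f (e x) = -(x i * x j * f x) := by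
    intro x
    have h1 : e x i = -x i := by simp [e]
    have h2 : e x j = x j := by simp [e, hij.symm]
    rw [hf (e x) x (e.norm_map x), h1, h2]
    ring
  have h := e.measurePreserving.integral_comp e.toHomeomorph.measurableEmbedding
    (fun x => x i * x j * f x)
  simp only [he, integral_neg] at h
  linarith

lemma integral_coord_sq_mul_radial {f : EuclideanSpace ℝ (Fin d) → ℝ}
    (hf : ∀ x y, ‖x‖ = ‖y‖ → f x = f y) (i j : Fin d) :
    ∫ x : EuclideanSpace ℝ (Fin d), x i * x i * f x
      = ∫ x : EuclideanSpace ℝ (Fin d), x j * x j * f x := by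
  let e : EuclideanSpace ℝ (Fin d) ≃ₗᵢ[ℝ] EuclideanSpace ℝ (Fin d) :=
    LinearIsometryEquiv.piLpCongrLeft 2 ℝ ℝ (Equiv.swap i j)
  have he : ∀ x, e x i * e x i * f (e x) = x j * x j * f x := by
    intro x
    have h1 : e x i = x j := by simp [e, LinearIsometryEquiv.piLpCongrLeft_apply]
    rw [hf (e x) x (e.norm_map x), h1]
  have h := e.measurePreserving.integral_comp e.toHomeomorph.measurableEmbedding
    (fun x => x i * x i * f x)
  simp only [he] at h
  exact h.symm

/-- Integrating a quadratic form against a radial weight only sees its trace. -/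
lemma integral_bilin_mul_radial (hd : 1 ≤ d) {f : EuclideanSpace ℝ (Fin d) → ℝ}
    (hf : ∀ x y, ‖x‖ = ‖y‖ → f x = f y)
    (hint : Integrable fun x : EuclideanSpace ℝ (Fin d) => ‖x‖ ^ 2 * f x)
    (hmeas : AEStronglyMeasurable f)
    (B : EuclideanSpace ℝ (Fin d) →L[ℝ] EuclideanSpace ℝ (Fin d) →L[ℝ] ℝ) :
    ∫ x, B x x * f x = (∑ i, B (EuclideanSpace.single i 1) (EuclideanSpace.single i 1)) / d *
      ∫ x : EuclideanSpace ℝ (Fin d), ‖x‖ ^ 2 * f x := by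
  have hij : ∀ i j : Fin d, Integrable fun x : EuclideanSpace ℝ (Fin d) => x i * x j * f x := by
    intro i j
    refine hint.mono ?_ (Filter.Eventually.of_forall fun x => ?_)
    · exact AEStronglyMeasurable.mul (by
        exact ((EuclideanSpace.proj (𝕜 := ℝ) i).continuous.mul
          (EuclideanSpace.proj (𝕜 := ℝ) j).continuous).aestronglyMeasurable) hmeas
    · rw [norm_mul, norm_mul, norm_mul, norm_pow, norm_norm, sq]
      gcongr <;> exact PiLp.norm_apply_le x _
  have hd0 : (d : ℝ) ≠ 0 := by positivity
  have hB : ∀ x : EuclideanSpace ℝ (Fin d), B x x * f x = ∑ i, ∑ j,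
      B (EuclideanSpace.single i 1) (EuclideanSpace.single j 1) * (x i * x j * f x) := by
    intro x
    have hx : x = ∑ i, x i • EuclideanSpace.single i (1 : ℝ) := by
      conv_lhs => rw [← (EuclideanSpace.basisFun (Fin d) ℝ).sum_repr x]
      simp
    conv_lhs => rw [hx]
    rw [← hx]
    nth_rewrite 1 [hx]
    rw [map_sum, _root_.sum_apply, Finset.sum_mul]
    refine Finset.sum_congr rfl fun i _ => ?_
    nth_rewrite 2 [hx]
    rw [map_sum, Finset.sum_mul]
    refine Finset.sum_congr rfl fun j _ => ?_
    simp only [map_smul, _root_.smul_apply, smul_eq_mul]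
    ring
  have hdiag : ∀ i : Fin d, ∫ x : EuclideanSpace ℝ (Fin d), x i * x i * f x
      = (∫ x : EuclideanSpace ℝ (Fin d), ‖x‖ ^ 2 * f x) / d := by
    intro i
    have : ∫ x : EuclideanSpace ℝ (Fin d), ‖x‖ ^ 2 * f x
        = ∑ j : Fin d, ∫ x : EuclideanSpace ℝ (Fin d), x j * x j * f x := by
      rw [← integral_finsetSum _ fun j _ => hij j j]
      congr 1 with x
      rw [EuclideanSpace.norm_sq_eq, Finset.sum_mul]
      refine Finset.sum_congr rfl fun j _ => ?_
      rw [norm_eq_abs, sq_abs, sq]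
    rw [this, Finset.sum_congr rfl fun j _ => integral_coord_sq_mul_radial hf j i]
    simp
    field_simp
  simp_rw [hB]
  rw [integral_finsetSum _ fun i _ => integrable_finsetSum _ fun j _ => (hij i j).const_mul _]
  rw [Finset.sum_div, Finset.sum_mul]
  refine Finset.sum_congr rfl fun i _ => ?_
  rw [integral_finsetSum _ fun j _ => (hij i j).const_mul _, Finset.sum_eq_single i]
  · rw [integral_const_mul, hdiag]
    ring
  · intro j _ hji
    rw [integral_const_mul, integral_coord_mul_coord_mul_radial hf hji.symm, mul_zero]
  · simp

end SymmetricTensor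

section Taylor

variable {E F : Type*} [NormedAddCommGroup E] [NormedSpace ℝ E]
  [NormedAddCommGroup F] [NormedSpace ℝ F]

lemma norm_le_mul_norm_pow_of_fderiv {f : E → F} {K ρ : ℝ} {n : ℕ} (hK : 0 ≤ K) (h0 : f 0 = 0)
    (hf : ∀ x ∈ ball (0 : E) ρ, DifferentiableAt ℝ f x)
    (hle : ∀ x ∈ ball (0 : E) ρ, ‖fderiv ℝ f x‖ ≤ K * ‖x‖ ^ n) :
    ∀ x ∈ ball (0 : E) ρ, ‖f x‖ ≤ K * ‖x‖ ^ (n + 1) := by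
  intro x hx
  have hsub : closedBall (0 : E) ‖x‖ ⊆ ball 0 ρ := closedBall_subset_ball (by simpa using hx)
  have h := (convex_closedBall (0 : E) ‖x‖).norm_image_sub_le_of_norm_fderiv_le (𝕜 := ℝ) (f := f)
    (C := K * ‖x‖ ^ n) (x := 0) (y := x) (fun z hz => hf z (hsub hz)) (fun z hz => ?_)
    (by simp) (by simp)
  · simpa [h0, pow_succ, mul_assoc] using h
  · refine (hle z (hsub hz)).trans ?_
    have : ‖z‖ ≤ ‖x‖ := by simpa using hz
    gcongr

/-- Second order Taylor expansion with cubic remainder at a critical zero. -/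
lemma exists_taylor_two {f : E → ℝ} (hf : ContDiffAt ℝ 3 f 0) (h0 : f 0 = 0)
    (h1 : fderiv ℝ f 0 = 0) :
    ∃ K > 0, ∃ ρ > 0, ∀ x ∈ ball (0 : E) ρ,
      |f x - fderiv ℝ (fderiv ℝ f) 0 x x / 2| ≤ K * ‖x‖ ^ 3 := by
  set B := fderiv ℝ (fderiv ℝ f) 0 with hB
  have hsymm : ∀ x y, B x y = B y x :=
    (hf.isSymmSndFDerivAt (by simp; norm_num)).eq
  have c1 : ContDiffAt ℝ 2 (fderiv ℝ f) 0 := hf.fderiv_right (by norm_num)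
  have c2 : ContDiffAt ℝ 1 (fderiv ℝ (fderiv ℝ f)) 0 := c1.fderiv_right (by norm_num)
  obtain ⟨k, s, hs, hk⟩ := c2.exists_lipschitzOnWith
  have ev : ∀ᶠ x in nhds (0 : E), DifferentiableAt ℝ f x ∧ DifferentiableAt ℝ (fderiv ℝ f) x ∧
      x ∈ s := by
    filter_upwards [hf.eventually (by simp), c1.eventually (by simp), hs] with x a b c
    exact ⟨a.differentiableAt (by norm_num), b.differentiableAt (by norm_num), c⟩
  obtain ⟨ρ, hρ, hball⟩ := Metric.eventually_nhds_iff_ball.1 ev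
  refine ⟨k + 1, by positivity, ρ, hρ, ?_⟩
  have s2 : ∀ x ∈ ball (0 : E) ρ, ‖fderiv ℝ (fderiv ℝ f) x - B‖ ≤ (k + 1) * ‖x‖ ^ 1 := by
    intro x hx
    have := hk.norm_sub_le (hball x hx).2.2 (hball 0 (mem_ball_self hρ)).2.2
    rw [sub_zero] at this
    rw [pow_one]
    refine this.trans ?_
    gcongr
    linarith
  have s1 : ∀ x ∈ ball (0 : E) ρ, ‖fderiv ℝ f x - B x‖ ≤ (k + 1) * ‖x‖ ^ (1 + 1) := by
    refine norm_le_mul_norm_pow_of_fderiv (by positivity) (by simp [h1])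
      (fun x hx => (hball x hx).2.1.sub B.differentiableAt) fun x hx => ?_
    have : fderiv ℝ (fun x => fderiv ℝ f x - B x) x = fderiv ℝ (fderiv ℝ f) x - B :=
      ((hball x hx).2.1.hasFDerivAt.sub B.hasFDerivAt).fderiv
    rw [this]
    exact s2 x hx
  have hq : ∀ x, HasFDerivAt (fun x => B x x / 2) (B x) x := by
    intro x
    have := (B.hasFDerivAt (x := x)).clm_apply (hasFDerivAt_id x)
    have h2 := this.mul_const (2⁻¹ : ℝ)
    simp only [id_eq, ← div_eq_mul_inv] at h2
    refine h2.congr_fderiv ?_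
    ext y
    simp [hsymm y x]
    ring
  refine norm_le_mul_norm_pow_of_fderiv (by positivity) (by simp [h0])
    (fun x hx => (hball x hx).1.sub (hq x).differentiableAt) fun x hx => ?_
  have : fderiv ℝ (fun x => f x - B x x / 2) x = fderiv ℝ f x - B x :=
    ((hball x hx).1.hasFDerivAt.sub (hq x)).fderiv
  exact (congrArg norm this).trans_le (s1 x hx)

end Taylor

lemma integral_mul_ite_le_eq {p : ℝ → ℝ} (hp : Integrable p) (heven : ∀ s, p (-s) = p s)
    (X : ℝ) :
    ∫ s, p s * (if s ≤ X then 1 else -1) = 2 * ∫ s in (0 : ℝ)..X, p s := by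
  have h1 : ∀ s, p s * (if s ≤ X then 1 else -1) = 2 * (Iic X).indicator p s - p s := by
    intro s
    by_cases hs : s ≤ X
    · simp [hs]; ring
    · simp [hs]
  have h2 : ∫ s in Iic (0 : ℝ), p s = ∫ s in Ioi (0 : ℝ), p s := by
    have := integral_comp_neg_Iic (0 : ℝ) p
    simpa [heven] using this
  have h3 := integral_add_compl (measurableSet_Iic (a := (0 : ℝ))) hp
  rw [compl_Iic, ← h2] at h3
  simp_rw [h1]
  rw [integral_sub ((hp.indicator measurableSet_Iic).const_mul 2) hp, integral_const_mul,
    integral_indicator measurableSet_Iic,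
    ← intervalIntegral.integral_Iic_sub_Iic hp.integrableOn hp.integrableOn]
  linarith

section Slices

variable {d : ℕ} {P : EuclideanSpace ℝ (Fin (d + 1)) → ℝ}

lemma continuous_integral_slice (hc : Continuous P) :
    Continuous fun q : EuclideanSpace ℝ (Fin d) × ℝ =>
      ∫ s in (0 : ℝ)..q.2, P (snocPt q.1 s) := by
  refine intervalIntegral.continuous_parametric_intervalIntegral_of_continuous
    (f := fun (q : EuclideanSpace ℝ (Fin d) × ℝ) s => P (snocPt q.1 s)) ?_ continuous_snd
  exact hc.comp ((continuous_snocPt d).comp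
    ((continuous_fst.comp continuous_fst).prodMk continuous_snd))

lemma continuous_comp_snocPt (hc : Continuous P) (y : EuclideanSpace ℝ (Fin d)) :
    Continuous fun s => P (snocPt y s) :=
  hc.comp ((continuous_snocPt d).comp (by fun_prop : Continuous fun s : ℝ => (y, s)))

lemma continuous_comp_snocPt_zero (hc : Continuous P) :
    Continuous fun y : EuclideanSpace ℝ (Fin d) => P (snocPt y 0) :=
  hc.comp ((continuous_snocPt d).comp
    (by fun_prop : Continuous fun y : EuclideanSpace ℝ (Fin d) => (y, (0 : ℝ))))

/-- If the signed density `τ` agrees with the sign of a subgraph inside a ball and has vanishing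
`P`-mean, then the signed `P`-mass between the graph and the hyperplane is controlled by the
tail of `P`. -/
lemma abs_setIntegral_slice_le (hc : Continuous P) (hi : Integrable P) (hpos : ∀ w, 0 ≤ P w)
    (heven : ∀ (y : EuclideanSpace ℝ (Fin d)) (s : ℝ), P (snocPt y (-s)) = P (snocPt y s))
    (hslice : ∀ y : EuclideanSpace ℝ (Fin d), Integrable fun s => P (snocPt y s))
    {τ : EuclideanSpace ℝ (Fin (d + 1)) → ℝ} (hτ : Measurable τ) (hτ1 : ∀ w, |τ w| ≤ 1)
    {X : EuclideanSpace ℝ (Fin d) → ℝ} {R : ℝ} (hX : ContinuousOn X (closedBall 0 R))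
    (hτX : ∀ y s, ‖snocPt y s‖ < R → s ≠ X y → τ (snocPt y s) = if s ≤ X y then 1 else -1)
    (h0 : ∫ w, P w * τ w = 0) :
    |∫ y in ball (0 : EuclideanSpace ℝ (Fin d)) R, ∫ s in (0 : ℝ)..X y, P (snocPt y s)| ≤
      ∫ w in (ball 0 R)ᶜ, P w := by
  set J : EuclideanSpace ℝ (Fin d) → ℝ := fun y => ∫ s in (0 : ℝ)..X y, P (snocPt y s) with hJ
  have hJint : IntegrableOn J (ball 0 R) := by
    refine (ContinuousOn.integrableOn_compact (isCompact_closedBall 0 R) ?_).mono_set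
      ball_subset_closedBall
    exact (continuous_integral_slice hc).comp_continuousOn (continuousOn_id.prodMk hX)
  set H : EuclideanSpace ℝ (Fin d) → ℝ := (ball 0 R).indicator fun y => 2 * J y with hH
  have hHint : Integrable H := IntegrableOn.integrable_indicator (hJint.const_mul 2) measurableSet_ball
  have hPτ : Integrable fun w => P w * τ w := by
    refine hi.mono (hc.measurable.mul hτ).aestronglyMeasurable
      (Filter.Eventually.of_forall fun w => ?_)
    rw [norm_mul]
    exact mul_le_of_le_one_right (norm_nonneg _) (hτ1 w)
  set T : EuclideanSpace ℝ (Fin (d + 1)) → ℝ := (ball 0 R)ᶜ.indicator fun w => 2 * P w with hT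
  have hTint : Integrable T := (hi.const_mul 2).indicator measurableSet_ball.compl
  have hT0 : ∀ w, 0 ≤ T w := fun w => indicator_nonneg (fun w _ => by linarith [hpos w]) w
  have hTsl : ∀ y : EuclideanSpace ℝ (Fin d), Integrable fun s => T (snocPt y s) := by
    intro y
    refine ((hslice y).const_mul 2).mono' ?_ (Filter.Eventually.of_forall fun s => ?_)
    · have hm : Measurable fun s : ℝ => snocPt y s :=
        ((continuous_snocPt d).comp (by fun_prop : Continuous fun s : ℝ => (y, s))).measurable
      exact (((hc.measurable.const_mul 2).indicator measurableSet_ball.compl).comp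
        hm).aestronglyMeasurable
    · rw [norm_of_nonneg (hT0 _)]
      exact indicator_le_self' (fun w _ => by linarith [hpos w]) _
  set G : EuclideanSpace ℝ (Fin d) → ℝ :=
    fun y => ∫ s, P (snocPt y s) * τ (snocPt y s) with hG
  have hGint : Integrable G := (Integrable.comp_snocPt hPτ).integral_prod_left
  have hG0 : ∫ y, G y = 0 := by
    rw [← h0, integral_eq_integral_snocPt, Measure.volume_eq_prod, integral_prod]
    exact Integrable.comp_snocPt hPτ
  have hle : ∀ y, ‖G y - H y‖ ≤ ∫ s, T (snocPt y s) := by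
    intro y
    by_cases hy : y ∈ ball (0 : EuclideanSpace ℝ (Fin d)) R
    · have e1 : H y = ∫ s, P (snocPt y s) * (if s ≤ X y then 1 else -1) := by
        rw [integral_mul_ite_le_eq (hslice y) (heven y), hH, indicator_of_mem hy]
      have hm : Measurable fun s : ℝ => snocPt y s :=
        ((continuous_snocPt d).comp (by fun_prop : Continuous fun s : ℝ => (y, s))).measurable
      have i1 : Integrable fun s => P (snocPt y s) * τ (snocPt y s) := by
        refine (hslice y).mono ((hc.measurable.comp hm).mul
          (hτ.comp hm)).aestronglyMeasurable (Filter.Eventually.of_forall fun s => ?_)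
        rw [norm_mul]
        exact mul_le_of_le_one_right (norm_nonneg _) (hτ1 _)
      have i2 : Integrable fun s => P (snocPt y s) * (if s ≤ X y then (1 : ℝ) else -1) := by
        refine (hslice y).mono ((hc.measurable.comp hm).mul
          (Measurable.ite measurableSet_Iic measurable_const
            measurable_const)).aestronglyMeasurable (Filter.Eventually.of_forall fun s => ?_)
        rw [norm_mul]
        refine mul_le_of_le_one_right (norm_nonneg _) ?_
        split_ifs <;> simp
      rw [e1, hG, ← integral_sub i1 i2]
      refine norm_integral_le_of_norm_le (hTsl y) ?_
      have hne : ∀ᵐ s : ℝ, s ≠ X y := by simp [ae_iff]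
      filter_upwards [hne] with s hs
      by_cases hsR : ‖snocPt y s‖ < R
      · rw [hτX y s hsR hs, sub_self, norm_zero]
        exact hT0 _
      · have : T (snocPt y s) = 2 * P (snocPt y s) :=
          indicator_of_mem (by simpa using hsR) _
        rw [this, ← mul_sub, norm_mul, norm_of_nonneg (hpos _), mul_comm]
        refine mul_le_mul_of_nonneg_right ?_ (hpos _)
        have h1 := abs_le.1 (hτ1 (snocPt y s))
        rw [norm_eq_abs, abs_le]
        split_ifs <;> constructor <;> linarith
    · have e1 : H y = 0 := indicator_of_notMem hy _
      rw [e1, sub_zero]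
      refine norm_integral_le_of_norm_le (hTsl y) (Filter.Eventually.of_forall fun s => ?_)
      have : T (snocPt y s) = 2 * P (snocPt y s) := by
        refine indicator_of_mem ?_ _
        have h1 : R ≤ ‖y‖ := by simpa using hy
        simpa using h1.trans (norm_le_norm_snocPt y s)
      rw [this, norm_mul, norm_of_nonneg (hpos _), mul_comm]
      refine mul_le_mul_of_nonneg_right ((hτ1 _).trans (by norm_num)) (hpos _)
  have hHi : ∫ y, H y = 2 * ∫ y in ball 0 R, J y := by
    rw [hH, integral_indicator measurableSet_ball, integral_const_mul]
  have hTi : ∫ y : EuclideanSpace ℝ (Fin d), ∫ s, T (snocPt y s)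
      = 2 * ∫ w in (ball 0 R)ᶜ, P w := by
    have : ∫ w, T w = 2 * ∫ w in (ball 0 R)ᶜ, P w := by
      rw [hT, integral_indicator measurableSet_ball.compl, integral_const_mul]
    rw [← this, integral_eq_integral_snocPt, Measure.volume_eq_prod, integral_prod]
    exact Integrable.comp_snocPt hTint
  have hTi' : Integrable fun y : EuclideanSpace ℝ (Fin d) => ∫ s, T (snocPt y s) :=
    (Integrable.comp_snocPt hTint).integral_prod_left
  have hfin := norm_integral_le_of_norm_le hTi' (Filter.Eventually.of_forall hle)
  rw [integral_sub hGint hHint, hG0, hHi, hTi, zero_sub, norm_neg, norm_mul, norm_eq_abs,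
    norm_eq_abs, abs_two] at hfin
  linarith

lemma abs_slice_sub_slice_le (hc : Continuous P) {y : EuclideanSpace ℝ (Fin d)} {A : ℝ}
    (hA : ∀ s, |P (snocPt y s)| ≤ A) (a b : ℝ) :
    |(∫ s in (0 : ℝ)..a, P (snocPt y s)) - ∫ s in (0 : ℝ)..b, P (snocPt y s)| ≤
      A * |a - b| := by
  have hI := fun a b => (continuous_comp_snocPt hc y).intervalIntegrable (μ := volume) a b
  rw [intervalIntegral.integral_interval_sub_left (hI _ _) (hI _ _)]
  exact intervalIntegral.norm_integral_le_of_norm_le_const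
    (f := fun s => P (snocPt y s)) fun s _ => hA s

lemma hasDerivAt_snocPt (y : EuclideanSpace ℝ (Fin d)) (s : ℝ) :
    HasDerivAt (fun s => snocPt y s) (snocPt 0 1) s := by
  have h : (fun s => snocPt y s) = fun s : ℝ => snocPt y 0 + s • snocPt 0 1 := by
    funext s
    rw [snocPt_add_smul]
    simp
  rw [h]
  simpa using ((hasDerivAt_id s).smul_const
    (snocPt (0 : EuclideanSpace ℝ (Fin d)) 1)).const_add (snocPt y 0)

lemma abs_slice_sub_mul_le (hP : ContDiff ℝ 1 P) {y : EuclideanSpace ℝ (Fin d)} {A : ℝ}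
    (hA : ∀ s, ‖fderiv ℝ P (snocPt y s)‖ ≤ A) (X : ℝ) :
    |(∫ s in (0 : ℝ)..X, P (snocPt y s)) - X * P (snocPt y 0)| ≤ A * X ^ 2 := by
  have hA0 : 0 ≤ A := (norm_nonneg _).trans (hA 0)
  have hn : ‖snocPt (0 : EuclideanSpace ℝ (Fin d)) 1‖ = 1 := by
    rw [← eN_eq_snocPt]
    simp [eN]
  have hd : ∀ s : ℝ, HasDerivAt (fun s => P (snocPt y s))
      (fderiv ℝ P (snocPt y s) (snocPt 0 1)) s := fun s =>
    ((hP.differentiable (by norm_num)) (snocPt y s)).hasFDerivAt.comp_hasDerivAt s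
      (hasDerivAt_snocPt y s)
  have hs : ∀ s, |P (snocPt y s) - P (snocPt y 0)| ≤ A * |s| := by
    intro s
    have := convex_univ.norm_image_sub_le_of_norm_hasDerivWithin_le (C := A)
      (fun s _ => (hd s).hasDerivWithinAt) (fun s _ => ?_) (mem_univ (0 : ℝ)) (mem_univ s)
    · simpa using this
    · refine (ContinuousLinearMap.le_opNorm _ _).trans ?_
      rw [hn, mul_one]
      exact hA s
  have e : (∫ s in (0 : ℝ)..X, P (snocPt y s)) - X * P (snocPt y 0)
      = ∫ s in (0 : ℝ)..X, (P (snocPt y s) - P (snocPt y 0)) := by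
    rw [intervalIntegral.integral_sub
      ((continuous_comp_snocPt hP.continuous y).intervalIntegrable _ _) (by simp)]
    simp
  rw [e]
  have := intervalIntegral.norm_integral_le_of_norm_le_const (a := 0) (b := X) (C := A * |X|)
    (f := fun s => P (snocPt y s) - P (snocPt y 0)) fun s hsX => ?_
  · rw [norm_eq_abs, sub_zero, mul_assoc, abs_mul_abs_self, ← sq] at this
    exact this
  · refine (hs s).trans (mul_le_mul_of_nonneg_left ?_ hA0)
    have := abs_sub_left_of_mem_uIcc (uIoc_subset_uIcc hsX)
    simpa using this

lemma slice_neg (heven : ∀ (y : EuclideanSpace ℝ (Fin d)) (s : ℝ),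
      P (snocPt y (-s)) = P (snocPt y s)) (y : EuclideanSpace ℝ (Fin d)) (a : ℝ) :
    ∫ s in (0 : ℝ)..(-a), P (snocPt y s) = -∫ s in (0 : ℝ)..a, P (snocPt y s) := by
  have h := intervalIntegral.integral_comp_neg (a := 0) (b := a) (fun s => P (snocPt y s))
  simp only [heven, neg_zero] at h
  rw [h, intervalIntegral.integral_symm]

lemma mul_abs_le_slice (hc : Continuous P) {y : EuclideanSpace ℝ (Fin d)} {c α : ℝ}
    (hα : 0 ≤ α) (hle : ∀ s, 0 ≤ s → s ≤ α → c ≤ P (snocPt y s)) :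
    c * α ≤ ∫ s in (0 : ℝ)..α, P (snocPt y s) := by
  have := intervalIntegral.integral_mono_on (a := 0) (b := α) (f := fun _ => c) hα (by simp)
    ((continuous_comp_snocPt hc y).intervalIntegrable (μ := volume) _ _)
    fun s hs => hle s hs.1 hs.2
  simpa [mul_comm] using this

end Slices

section Expansion

variable {d : ℕ} {P : EuclideanSpace ℝ (Fin (d + 1)) → ℝ} {𝒞 : ℝ}

lemma div_one_add_norm_snocPt_le {C : ℝ} (hC : 0 ≤ C) (y : EuclideanSpace ℝ (Fin d)) (s : ℝ)
    (n : ℕ) : C / (1 + ‖snocPt y s‖ ^ n) ≤ C / (1 + ‖y‖ ^ n) := by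
  have := norm_le_norm_snocPt y s
  gcongr

lemma continuous_norm_pow_div (k n : ℕ) :
    Continuous fun y : EuclideanSpace ℝ (Fin d) => ‖y‖ ^ k / (1 + ‖y‖ ^ n) :=
  (by fun_prop : Continuous fun y : EuclideanSpace ℝ (Fin d) => ‖y‖ ^ k).div (by fun_prop)
    fun y => by positivity

lemma Continuous.integrableOn_euclidean_ball {f : EuclideanSpace ℝ (Fin d) → ℝ}
    (hf : Continuous f) (R : ℝ) : IntegrableOn f (ball 0 R) :=
  (hf.continuousOn.integrableOn_compact (isCompact_closedBall 0 R)).mono_set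
    ball_subset_closedBall

lemma integrableOn_slice (hc : Continuous P) {X : EuclideanSpace ℝ (Fin d) → ℝ} {R : ℝ}
    (hX : ContinuousOn X (closedBall 0 R)) :
    IntegrableOn (fun y => ∫ s in (0 : ℝ)..X y, P (snocPt y s)) (ball 0 R) := by
  refine (ContinuousOn.integrableOn_compact (isCompact_closedBall 0 R) ?_).mono_set
    ball_subset_closedBall
  exact (continuous_integral_slice hc).comp_continuousOn (continuousOn_id.prodMk hX)

/-- A priori bound on the height of the zero. -/
lemma mul_abs_le_abs_setIntegral_slice_add (hc : Continuous P) (h𝒞 : 0 < 𝒞)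
    (hlow : ∀ w, 𝒞⁻¹ / (1 + ‖w‖ ^ (d + 2)) ≤ P w)
    (hup : ∀ w, P w ≤ 𝒞 / (1 + ‖w‖ ^ (d + 2)))
    (heven : ∀ (y : EuclideanSpace ℝ (Fin d)) (s : ℝ), P (snocPt y (-s)) = P (snocPt y s))
    {α N R : ℝ} (hα : |α| ≤ 1) (hR : 1 ≤ R) {g : EuclideanSpace ℝ (Fin d) → ℝ}
    (hg : ContinuousOn g (closedBall 0 R)) (hgN : ∀ y ∈ ball 0 R, |g y| ≤ N * ‖y‖ ^ 2) :
    𝒞⁻¹ / (1 + 2 ^ (d + 2)) * volume.real (ball (0 : EuclideanSpace ℝ (Fin d)) 1) * |α| ≤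
      |∫ y in ball (0 : EuclideanSpace ℝ (Fin d)) R,
        ∫ s in (0 : ℝ)..(α - g y), P (snocPt y s)| +
      𝒞 * N * ∫ y in ball (0 : EuclideanSpace ℝ (Fin d)) R, ‖y‖ ^ 2 / (1 + ‖y‖ ^ (d + 2)) := by
  set c : ℝ := 𝒞⁻¹ / (1 + 2 ^ (d + 2)) with hcdef
  have hpos : ∀ w, 0 ≤ P w := fun w => le_trans (by positivity) (hlow w)
  obtain ⟨ε, hε1, hεα, hεJ⟩ : ∃ ε : ℝ, |ε| = 1 ∧ ε * α = |α| ∧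
      ∀ y : EuclideanSpace ℝ (Fin d), ε * ∫ s in (0 : ℝ)..α, P (snocPt y s) =
        ∫ s in (0 : ℝ)..|α|, P (snocPt y s) := by
    rcases le_total 0 α with h | h
    · exact ⟨1, by simp, by simp [abs_of_nonneg h], fun y => by simp [abs_of_nonneg h]⟩
    · exact ⟨-1, by simp, by simp [abs_of_nonpos h], fun y => by
        rw [abs_of_nonpos h, slice_neg heven]; ring⟩
  have hJint := integrableOn_slice hc (X := fun y => α - g y) (R := R)
    (continuousOn_const.sub hg)
  have hWint := (continuous_norm_pow_div (d := d) 2 (d + 2)).integrableOn_euclidean_ball R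
  have hpt : ∀ y ∈ ball (0 : EuclideanSpace ℝ (Fin d)) R,
      (ball (0 : EuclideanSpace ℝ (Fin d)) 1).indicator (fun _ => c * |α|) y ≤
        ε * (∫ s in (0 : ℝ)..(α - g y), P (snocPt y s)) +
          𝒞 * N * (‖y‖ ^ 2 / (1 + ‖y‖ ^ (d + 2))) := by
    intro y hy
    have h1 : |(∫ s in (0 : ℝ)..(α - g y), P (snocPt y s)) - ∫ s in (0 : ℝ)..α, P (snocPt y s)|
        ≤ 𝒞 * N * (‖y‖ ^ 2 / (1 + ‖y‖ ^ (d + 2))) := by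
      refine (abs_slice_sub_slice_le hc (A := 𝒞 / (1 + ‖y‖ ^ (d + 2))) (fun s => ?_) _ _).trans ?_
      · rw [abs_of_nonneg (hpos _)]
        exact (hup _).trans (div_one_add_norm_snocPt_le h𝒞.le y s _)
      · rw [sub_sub_cancel_left, abs_neg]
        refine (mul_le_mul_of_nonneg_left (hgN y hy) (by positivity)).trans (le_of_eq ?_)
        ring
    have h2 : (ball (0 : EuclideanSpace ℝ (Fin d)) 1).indicator (fun _ => c * |α|) y ≤
        ∫ s in (0 : ℝ)..|α|, P (snocPt y s) := by
      by_cases hy1 : y ∈ ball (0 : EuclideanSpace ℝ (Fin d)) 1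
      · rw [indicator_of_mem hy1]
        refine mul_abs_le_slice hc (abs_nonneg _) fun s hs0 hs => le_trans ?_ (hlow _)
        have hyn : ‖y‖ < 1 := by simpa using hy1
        have : ‖snocPt y s‖ ≤ 2 := by
          refine (sq_le_sq₀ (norm_nonneg _) (by norm_num)).1 ?_
          rw [norm_sq_snocPt]
          nlinarith [norm_nonneg y]
        rw [hcdef]
        gcongr
      · rw [indicator_of_notMem hy1]
        simpa using mul_abs_le_slice (c := 0) hc (abs_nonneg α) fun s _ _ => hpos (snocPt y s)
    have h3 : |ε * ((∫ s in (0 : ℝ)..(α - g y), P (snocPt y s)) -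
        ∫ s in (0 : ℝ)..α, P (snocPt y s))| ≤ 𝒞 * N * (‖y‖ ^ 2 / (1 + ‖y‖ ^ (d + 2))) := by
      rwa [abs_mul, hε1, one_mul]
    have h4 := (abs_le.1 h3).1
    rw [mul_sub, hεJ] at h4
    linarith
  have hmono := setIntegral_mono_on (μ := volume)
    ((integrable_indicator_iff measurableSet_ball).2
      (integrableOn_const (measure_ball_lt_top.ne))).integrableOn
    ((hJint.const_mul ε).add (hWint.const_mul (𝒞 * N))) measurableSet_ball hpt
  have hl : ∫ y in ball (0 : EuclideanSpace ℝ (Fin d)) R,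
      (ball (0 : EuclideanSpace ℝ (Fin d)) 1).indicator (fun _ => c * |α|) y
      = c * volume.real (ball (0 : EuclideanSpace ℝ (Fin d)) 1) * |α| := by
    rw [setIntegral_indicator measurableSet_ball,
      inter_eq_self_of_subset_right (ball_subset_ball hR), setIntegral_const, smul_eq_mul]
    ring
  simp only [Pi.add_apply] at hmono
  rw [hl, integral_add (hJint.const_mul ε) (hWint.const_mul (𝒞 * N)), integral_const_mul,
    integral_const_mul] at hmono
  refine hmono.trans ?_
  gcongr
  refine (le_abs_self _).trans ?_
  rw [abs_mul, hε1, one_mul]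

/-- First order expansion of the signed mass between a graph and the horizontal hyperplane. -/
lemma abs_mul_sub_le_abs_setIntegral_slice_add (hP : ContDiff ℝ 1 P) (h𝒞 : 0 < 𝒞)
    (hpos : ∀ w, 0 ≤ P w)
    (hup : ∀ w, P w ≤ 𝒞 / (1 + ‖w‖ ^ (d + 2)))
    (hgrad : ∀ w, ‖fderiv ℝ P w‖ ≤ 𝒞 / (1 + ‖w‖ ^ (d + 3)))
    {α N K ν R : ℝ} {g : EuclideanSpace ℝ (Fin d) → ℝ}
    (B : EuclideanSpace ℝ (Fin d) →L[ℝ] EuclideanSpace ℝ (Fin d) →L[ℝ] ℝ)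
    (hg : ContinuousOn g (closedBall 0 R)) (hgN : ∀ y ∈ ball 0 R, |g y| ≤ N * ‖y‖ ^ 2)
    (hgB : ∀ y ∈ ball 0 R, |g y - ν * B y y| ≤ K * ‖y‖ ^ 3) :
    |α * (∫ y in ball (0 : EuclideanSpace ℝ (Fin d)) R, P (snocPt y 0)) -
        ν * ∫ y in ball (0 : EuclideanSpace ℝ (Fin d)) R, B y y * P (snocPt y 0)| ≤
      |∫ y in ball (0 : EuclideanSpace ℝ (Fin d)) R,
        ∫ s in (0 : ℝ)..(α - g y), P (snocPt y s)| +
      (2 * 𝒞 * α ^ 2 *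
          (∫ y in ball (0 : EuclideanSpace ℝ (Fin d)) R, ‖y‖ ^ 0 / (1 + ‖y‖ ^ (d + 3))) +
        2 * 𝒞 * N ^ 2 *
          (∫ y in ball (0 : EuclideanSpace ℝ (Fin d)) R, ‖y‖ ^ 4 / (1 + ‖y‖ ^ (d + 3))) +
        𝒞 * K *
          ∫ y in ball (0 : EuclideanSpace ℝ (Fin d)) R, ‖y‖ ^ 3 / (1 + ‖y‖ ^ (d + 2))) := by
  have hc := hP.continuous
  have hJint := integrableOn_slice hc (X := fun y => α - g y) (R := R)
    (continuousOn_const.sub hg)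
  have hW := fun k n => (continuous_norm_pow_div (d := d) k n).integrableOn_euclidean_ball R
  have hp0 := (continuous_comp_snocPt_zero hc)
  have hp := hp0.integrableOn_euclidean_ball R
  have hB : IntegrableOn (fun y => B y y * P (snocPt y 0)) (ball 0 R) :=
    Continuous.integrableOn_euclidean_ball ((by fun_prop : Continuous fun y => B y y).mul hp0) R
  have hpt : ∀ y ∈ ball (0 : EuclideanSpace ℝ (Fin d)) R,
      ‖(∫ s in (0 : ℝ)..(α - g y), P (snocPt y s)) -
        (α * P (snocPt y 0) - ν * (B y y * P (snocPt y 0)))‖ ≤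
        2 * 𝒞 * α ^ 2 * (‖y‖ ^ 0 / (1 + ‖y‖ ^ (d + 3))) +
          2 * 𝒞 * N ^ 2 * (‖y‖ ^ 4 / (1 + ‖y‖ ^ (d + 3))) +
          𝒞 * K * (‖y‖ ^ 3 / (1 + ‖y‖ ^ (d + 2))) := by
    intro y hy
    have h1 := abs_slice_sub_mul_le hP (y := y) (A := 𝒞 / (1 + ‖y‖ ^ (d + 3)))
      (fun s => (hgrad _).trans (div_one_add_norm_snocPt_le h𝒞.le y s _)) (α - g y)
    have h2 : (α - g y) ^ 2 ≤ 2 * α ^ 2 + 2 * (N * ‖y‖ ^ 2) ^ 2 := by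
      have : g y ^ 2 ≤ (N * ‖y‖ ^ 2) ^ 2 := by
        rw [← sq_abs]
        exact pow_le_pow_left₀ (abs_nonneg _) (hgN y hy) 2
      nlinarith [sq_nonneg (α + g y)]
    have h3 : |(g y - ν * B y y) * P (snocPt y 0)| ≤
        K * ‖y‖ ^ 3 * (𝒞 / (1 + ‖y‖ ^ (d + 2))) := by
      rw [abs_mul, abs_of_nonneg (hpos _)]
      refine mul_le_mul (hgB y hy) ((hup _).trans (div_one_add_norm_snocPt_le h𝒞.le y 0 _))
        (hpos _) ((abs_nonneg _).trans (hgB y hy))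
    have h4 := mul_le_mul_of_nonneg_left h2
      (by positivity : 0 ≤ 𝒞 / (1 + ‖y‖ ^ (d + 3)))
    have e : (∫ s in (0 : ℝ)..(α - g y), P (snocPt y s)) -
        (α * P (snocPt y 0) - ν * (B y y * P (snocPt y 0))) =
        ((∫ s in (0 : ℝ)..(α - g y), P (snocPt y s)) - (α - g y) * P (snocPt y 0)) -
          (g y - ν * B y y) * P (snocPt y 0) := by ring
    rw [e, norm_eq_abs]
    refine (abs_sub _ _).trans ((add_le_add (h1.trans h4) h3).trans (le_of_eq ?_))
    ring
  have h12 : IntegrableOn (fun y : EuclideanSpace ℝ (Fin d) =>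
      2 * 𝒞 * α ^ 2 * (‖y‖ ^ 0 / (1 + ‖y‖ ^ (d + 3))) +
        2 * 𝒞 * N ^ 2 * (‖y‖ ^ 4 / (1 + ‖y‖ ^ (d + 3)))) (ball 0 R) :=
    ((hW 0 (d + 3)).const_mul (2 * 𝒞 * α ^ 2)).add ((hW 4 (d + 3)).const_mul (2 * 𝒞 * N ^ 2))
  have hMain : IntegrableOn (fun y : EuclideanSpace ℝ (Fin d) =>
      α * P (snocPt y 0) - ν * (B y y * P (snocPt y 0))) (ball 0 R) :=
    (hp.const_mul α).sub (hB.const_mul ν)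
  have h := norm_integral_le_of_norm_le (μ := volume.restrict (ball 0 R))
    (h12.add ((hW 3 (d + 2)).const_mul (𝒞 * K)))
    (ae_restrict_of_forall_mem measurableSet_ball hpt)
  rw [integral_sub hJint hMain, integral_sub (hp.const_mul α) (hB.const_mul ν)] at h
  simp only [Pi.add_apply] at h
  rw [integral_add h12 ((hW 3 (d + 2)).const_mul (𝒞 * K)),
    integral_add ((hW 0 (d + 3)).const_mul (2 * 𝒞 * α ^ 2))
      ((hW 4 (d + 3)).const_mul (2 * 𝒞 * N ^ 2))] at h
  simp only [integral_const_mul, norm_eq_abs] at h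
  rw [abs_sub_comm] at h
  have h5 := abs_sub_abs_le_abs_sub (α * (∫ y in ball (0 : EuclideanSpace ℝ (Fin d)) R,
      P (snocPt y 0)) - ν * ∫ y in ball (0 : EuclideanSpace ℝ (Fin d)) R, B y y * P (snocPt y 0))
    (∫ y in ball (0 : EuclideanSpace ℝ (Fin d)) R, ∫ s in (0 : ℝ)..(α - g y), P (snocPt y s))
  linarith

/-- The truncated second moments at comparable radii differ by a bounded amount. -/
lemma abs_setIntegral_ball_sub_le (hc : Continuous P) (h𝒞 : 0 < 𝒞) (hpos : ∀ w, 0 ≤ P w)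
    (hup : ∀ w, P w ≤ 𝒞 / (1 + ‖w‖ ^ (d + 2))) {R R' : ℝ} (hR : 0 < R) (hRR' : R ≤ R') :
    |(∫ y in ball (0 : EuclideanSpace ℝ (Fin d)) R, ‖y‖ ^ 2 * P (snocPt y 0)) -
        ∫ y in ball (0 : EuclideanSpace ℝ (Fin d)) R', ‖y‖ ^ 2 * P (snocPt y 0)| ≤
      𝒞 * (R' / R) ^ d * volume.real (ball (0 : EuclideanSpace ℝ (Fin d)) 1) := by
  have hI : ∀ R, IntegrableOn (fun y : EuclideanSpace ℝ (Fin d) => ‖y‖ ^ 2 * P (snocPt y 0))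
      (ball 0 R) := fun R => Continuous.integrableOn_euclidean_ball
    ((by fun_prop : Continuous fun y : EuclideanSpace ℝ (Fin d) => ‖y‖ ^ 2).mul
      (continuous_comp_snocPt_zero hc)) R
  have hsub := ball_subset_ball (x := (0 : EuclideanSpace ℝ (Fin d))) hRR'
  have hvol : volume.real (ball (0 : EuclideanSpace ℝ (Fin d)) R')
      = R' ^ d * volume.real (ball (0 : EuclideanSpace ℝ (Fin d)) 1) := by
    have hpos' := hR.trans_le hRR'
    rw [Measure.real, Measure.addHaar_ball_of_pos _ _ hpos', ENNReal.toReal_mul,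
      ENNReal.toReal_ofReal (by positivity), finrank_euclideanSpace, Fintype.card_fin, Measure.real]
  rw [abs_sub_comm, ← setIntegral_sdiff measurableSet_ball (hI R') hsub]
  have hfin : volume (ball (0 : EuclideanSpace ℝ (Fin d)) R' \ ball 0 R) < ⊤ :=
    (measure_mono sdiff_subset).trans_lt measure_ball_lt_top
  rw [← norm_eq_abs]
  refine (norm_setIntegral_le_of_norm_le_const (C := 𝒞 / R ^ d) hfin fun y hy => ?_).trans ?_
  · have hy' : R ≤ ‖y‖ := by simpa using hy.2
    have hy0 : 0 < ‖y‖ := hR.trans_le hy'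
    rw [norm_of_nonneg (mul_nonneg (by positivity) (hpos _))]
    calc ‖y‖ ^ 2 * P (snocPt y 0) ≤ ‖y‖ ^ 2 * (𝒞 / ‖y‖ ^ (d + 2)) := by
          gcongr
          refine ((hup _).trans (div_one_add_norm_snocPt_le h𝒞.le y 0 _)).trans ?_
          gcongr
          linarith
      _ = 𝒞 / ‖y‖ ^ d := by
          rw [pow_add]
          field_simp
      _ ≤ 𝒞 / R ^ d := by gcongr
  · have : volume.real (ball (0 : EuclideanSpace ℝ (Fin d)) R' \ ball 0 R) ≤
        volume.real (ball (0 : EuclideanSpace ℝ (Fin d)) R') :=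
      measureReal_mono sdiff_subset measure_ball_lt_top.ne
    rw [hvol] at this
    refine (mul_le_mul_of_nonneg_left this (by positivity)).trans (le_of_eq ?_)
    rw [div_pow]
    ring

end Expansion

section Indicator

variable {d : ℕ} {E : Set (EuclideanSpace ℝ (Fin (d + 1)))}

lemma measurable_tauE (hE : IsOpen E) : Measurable (tauE E) :=
  (measurable_const.indicator hE.measurableSet).sub
    (measurable_const.indicator isClosed_closure.measurableSet.compl)

lemma abs_tauE_le_one (w : EuclideanSpace ℝ (Fin (d + 1))) : |tauE E w| ≤ 1 := by
  unfold tauE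
  by_cases h : w ∈ E
  · simp [h, subset_closure h]
  · by_cases h' : w ∈ closure E <;> simp [h, h']

lemma tauE_of_mem {w : EuclideanSpace ℝ (Fin (d + 1))} (h : w ∈ E) : tauE E w = 1 := by
  simp [tauE, h, subset_closure h]

lemma tauE_of_notMem_closure {w : EuclideanSpace ℝ (Fin (d + 1))} (h : w ∉ closure E) :
    tauE E w = -1 := by
  have h' : w ∉ E := fun h' => h (subset_closure h')
  simp [tauE, h, h']

lemma snocPt_notMem_closure {γ : EuclideanSpace ℝ (Fin d) → ℝ} {r : ℝ}
    (hγ : ContinuousOn γ (ball 0 r))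
    (hE : ∀ (y : EuclideanSpace ℝ (Fin d)) (a : ℝ), ‖y‖ < r → |a| < r →
      (snocPt y a ∈ E ↔ γ y < a))
    {y : EuclideanSpace ℝ (Fin d)} {a : ℝ} (hy : ‖y‖ < r) (ha : |a| < r) (hlt : a < γ y) :
    snocPt y a ∉ closure E := by
  let φ : EuclideanSpace ℝ (Fin (d + 1)) → EuclideanSpace ℝ (Fin d) × ℝ :=
    fun w => (WithLp.toLp 2 fun i => w i.castSucc, w (Fin.last d))
  have hφ : Continuous φ := by
    refine Continuous.prodMk ?_ (EuclideanSpace.proj (𝕜 := ℝ) (Fin.last d)).continuous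
    refine (PiLp.continuous_toLp 2 _).comp (continuous_pi fun i => ?_)
    exact (EuclideanSpace.proj (𝕜 := ℝ) i.castSucc).continuous
  have hinv : ∀ w, snocPt (φ w).1 (φ w).2 = w := by
    intro w
    ext i
    refine Fin.lastCases ?_ (fun j => ?_) i
    · simp [snocPt_apply_last, φ]
    · simp [snocPt_apply_castSucc, φ]
  have hinv' : φ (snocPt y a) = (y, a) := by
    refine Prod.ext ?_ ?_
    · ext i
      simp [φ, snocPt_apply_castSucc]
    · simp [φ, snocPt_apply_last]
  have hγc : ContinuousAt γ y := hγ.continuousAt (isOpen_ball.mem_nhds (by simpa using hy))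
  have ev : ∀ᶠ q : EuclideanSpace ℝ (Fin d) × ℝ in nhds (y, a),
      ‖q.1‖ < r ∧ |q.2| < r ∧ q.2 < γ q.1 := by
    have c1 : ContinuousAt (fun q : EuclideanSpace ℝ (Fin d) × ℝ => γ q.1) (y, a) :=
      ContinuousAt.comp (f := Prod.fst) (x := (y, a)) hγc continuousAt_fst
    exact ((by fun_prop : ContinuousAt (fun q : EuclideanSpace ℝ (Fin d) × ℝ => ‖q.1‖)
        (y, a)).eventually_lt_const hy).and
      (((by fun_prop : ContinuousAt (fun q : EuclideanSpace ℝ (Fin d) × ℝ => |q.2|)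
        (y, a)).eventually_lt_const ha).and (continuousAt_snd.eventually_lt c1 hlt))
  have ev' := (hφ.tendsto (snocPt y a)).eventually (hinv'.symm ▸ ev)
  rw [mem_closure_iff_frequently, Filter.not_frequently]
  filter_upwards [ev'] with w ⟨h1, h2, h3⟩ hw
  rw [← hinv w, hE _ _ h1 h2] at hw
  linarith

end Indicator

section Asymptotics

lemma log_inv_sq_mul_le {s : ℝ} (hs : 0 < s) (hs1 : s < 1) : s * log (1 / s) ^ 2 ≤ 4 := by
  have hx : 0 < 1 / s := by positivity
  have h1 : log (1 / s) ≤ 2 * √(1 / s) := by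
    have h := log_le_sub_one_of_pos (sqrt_pos.2 hx)
    rw [log_sqrt hx.le] at h
    linarith [sqrt_nonneg (1 / s)]
  have h0 : 0 ≤ log (1 / s) := log_nonneg (by rw [le_div_iff₀ hs]; linarith)
  have h2 := pow_le_pow_left₀ h0 h1 2
  rw [mul_pow, sq_sqrt hx.le] at h2
  calc s * log (1 / s) ^ 2 ≤ s * (2 ^ 2 * (1 / s)) := by gcongr
    _ = 4 := by field_simp; norm_num

/-- The bound on the rescaled graph obtained from its Taylor expansion. -/
lemma rescaled_taylor {V : Type*} [NormedAddCommGroup V] [NormedSpace ℝ V] {γ : V → ℝ}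
    {B : V →L[ℝ] V →L[ℝ] ℝ} {K ρ s : ℝ} (hK : 0 ≤ K) (hρ1 : ρ ≤ 1) (hs : 0 < s)
    (hγ : ∀ x ∈ ball (0 : V) ρ, |γ x - B x x / 2| ≤ K * ‖x‖ ^ 3) {y : V}
    (hy : y ∈ ball (0 : V) (ρ / s)) :
    |γ (-(s • y)) / s| ≤ (‖B‖ + K) * s * ‖y‖ ^ 2 ∧
      |γ (-(s • y)) / s - s / 2 * B y y| ≤ K * s ^ 2 * ‖y‖ ^ 3 := by
  have hn : ‖-(s • y)‖ = s * ‖y‖ := by rw [norm_neg, norm_smul, norm_of_nonneg hs.le]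
  have hlt : s * ‖y‖ < ρ := by
    have : ‖y‖ < ρ / s := by simpa using hy
    rw [lt_div_iff₀ hs] at this
    linarith
  have h := hγ (-(s • y)) (by rw [mem_ball_zero_iff, hn]; exact hlt)
  have hB : B (-(s • y)) (-(s • y)) = s ^ 2 * B y y := by
    simp [sq, mul_assoc]
  rw [hB, hn] at h
  have h2 : |γ (-(s • y)) / s - s / 2 * B y y| ≤ K * s ^ 2 * ‖y‖ ^ 3 := by
    have e : γ (-(s • y)) / s - s / 2 * B y y = (γ (-(s • y)) - s ^ 2 * B y y / 2) / s := by
      field_simp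
    rw [e, abs_div, abs_of_pos hs, div_le_iff₀ hs]
    exact h.trans (le_of_eq (by ring))
  refine ⟨?_, h2⟩
  have hBy : |B y y| ≤ ‖B‖ * ‖y‖ ^ 2 := by
    have := B.le_opNorm₂ y y
    rwa [norm_eq_abs, mul_assoc, ← sq] at this
  have h3 : K * s ^ 2 * ‖y‖ ^ 3 ≤ K * s * ‖y‖ ^ 2 := by
    have : K * s ^ 2 * ‖y‖ ^ 3 = K * s * ‖y‖ ^ 2 * (s * ‖y‖) := by ring
    rw [this]
    exact mul_le_of_le_one_right (by positivity) (by linarith)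
  have h4 : |s / 2 * B y y| ≤ ‖B‖ * s * ‖y‖ ^ 2 := by
    rw [abs_mul, abs_of_pos (by positivity)]
    have : 0 ≤ ‖B‖ * ‖y‖ ^ 2 := by positivity
    nlinarith [abs_nonneg (B y y)]
  have h5 := abs_add_le (γ (-(s • y)) / s - s / 2 * B y y) (s / 2 * B y y)
  rw [sub_add_cancel] at h5
  linarith

end Asymptotics

set_option maxHeartbeats 2000000 in

/-- Proposition 5.1, normal velocity for `s = 1/2`:
`v = b_N(t) H(0) + O(1/log(1/σ(t)))`, with `H(0) = Δγ(0)/(N−1)`. -/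
theorem stmt15
    (d : ℕ) (hd : 1 ≤ d)
    (P : EuclideanSpace ℝ (Fin (d + 1)) → ℝ)
    (hPrad : ∀ x y, ‖x‖ = ‖y‖ → P x = P y)
    (hP1 : ContDiff ℝ 1 P)
    (𝒞 : ℝ) (h𝒞 : 1 ≤ 𝒞)
    (hPlow : ∀ y, 𝒞⁻¹ / (1 + ‖y‖ ^ ((d : ℝ) + 2)) ≤ P y)
    (hPup : ∀ y, P y ≤ 𝒞 / (1 + ‖y‖ ^ ((d : ℝ) + 2)))
    (hPgrad : ∀ y, ‖fderiv ℝ P y‖ ≤ 𝒞 / (1 + ‖y‖ ^ ((d : ℝ) + 3)))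
    (CN : ℝ) (hCN : 0 < CN)
    (hlim : ∀ K : Set (EuclideanSpace ℝ (Fin (d + 1))), IsCompact K →
      (0 : EuclideanSpace ℝ (Fin (d + 1))) ∉ K →
      TendstoUniformlyOn (fun t y => t⁻¹ * ker12 P y t)
        (fun y => CN / ‖y‖ ^ ((d : ℝ) + 2)) (nhdsWithin 0 (Set.Ioi 0)) K)
    (E : Set (EuclideanSpace ℝ (Fin (d + 1))))
    (hEopen : IsOpen E) (hEbdd : Bornology.IsBounded E)
    (h0E : (0 : EuclideanSpace ℝ (Fin (d + 1))) ∈ frontier E)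
    (r : ℝ) (hr : 0 < r)
    (γ : EuclideanSpace ℝ (Fin d) → ℝ)
    (hγ3 : ContDiffOn ℝ 3 γ (ball 0 r))
    (hγ0 : γ 0 = 0)
    (hdγ0 : fderivWithin ℝ γ (ball 0 r) 0 = 0)
    (m : ℝ) (hm : m < r)
    (hγm : ∀ y' ∈ ball (0 : EuclideanSpace ℝ (Fin d)) r, |γ y'| ≤ m)
    (hEQ : ∀ (y' : EuclideanSpace ℝ (Fin d)) (a : ℝ), ‖y'‖ < r → |a| < r →
      (snocPt y' a ∈ E ↔ γ y' < a))
    (σ : ℝ → ℝ)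
    (hσ : ∀ t ∈ Set.Ioo (0 : ℝ) (1 / (2 * Real.exp 1)),
      σ t ∈ Set.Ioo (0 : ℝ) (Real.exp (-(1 / 2))) ∧
        (σ t) ^ 2 * Real.log (1 / σ t) = t) :
    ∃ C > (0 : ℝ), ∃ t₀ > (0 : ℝ), ∀ t ∈ Set.Ioo (0 : ℝ) t₀, ∀ v : ℝ,
      |v * t| ≤ σ t →
      uF12 P E ((v * t) • eN d) (σ t) = 0 →
      |v - ((∫ y' in ball (0 : EuclideanSpace ℝ (Fin d)) (1 / σ t),
              ‖y'‖ ^ 2 * P (snocPt y' 0)) /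
            (2 * Real.log (1 / σ t) *
              ∫ y' : EuclideanSpace ℝ (Fin d), P (snocPt y' 0))) * (lap0 γ / d)| ≤
        C / Real.log (1 / σ t) := by
  have h𝒞0 : 0 < 𝒞 := by linarith
  have hup : ∀ w, P w ≤ 𝒞 / (1 + ‖w‖ ^ (d + 2)) := fun w => by
    have := hPup w
    exact_mod_cast this
  have hlow : ∀ w, 𝒞⁻¹ / (1 + ‖w‖ ^ (d + 2)) ≤ P w := fun w => by
    have := hPlow w
    exact_mod_cast this
  have hgrad : ∀ w, ‖fderiv ℝ P w‖ ≤ 𝒞 / (1 + ‖w‖ ^ (d + 3)) := fun w => by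
    have := hPgrad w
    exact_mod_cast this
  have hpos : ∀ w, 0 < P w := fun w => lt_of_lt_of_le (by positivity) (hlow w)
  have hpos' : ∀ w, 0 ≤ P w := fun w => (hpos w).le
  have hc : Continuous P := hP1.continuous
  have heven : ∀ (y : EuclideanSpace ℝ (Fin d)) (s : ℝ),
      P (snocPt y (-s)) = P (snocPt y s) := fun y s => hPrad _ _
    ((pow_left_inj₀ (norm_nonneg _) (norm_nonneg _) two_ne_zero).1
      (by rw [norm_sq_snocPt, norm_sq_snocPt, neg_sq]))
  have : Nonempty (Fin d) := ⟨⟨0, hd⟩⟩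
  have hfr : Module.finrank ℝ (EuclideanSpace ℝ (Fin d)) = d := by simp
  have hfr' : Module.finrank ℝ (EuclideanSpace ℝ (Fin (d + 1))) = d + 1 := by simp
  have hi : Integrable P := by
    refine ((integrable_inv_one_add_norm_pow (V := EuclideanSpace ℝ (Fin (d + 1)))
      (n := d + 2) (by omega)).const_mul 𝒞).mono' hc.aestronglyMeasurable
      (Filter.Eventually.of_forall fun w => ?_)
    rw [norm_of_nonneg (hpos' w), mul_one_div]
    exact hup w
  have hslice : ∀ y : EuclideanSpace ℝ (Fin d), Integrable fun s => P (snocPt y s) := by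
    intro y
    refine ((integrable_inv_one_add_norm_pow (V := ℝ)
      (n := d + 2) (by simp)).const_mul 𝒞).mono'
      (continuous_comp_snocPt hc y).aestronglyMeasurable
      (Filter.Eventually.of_forall fun s => ?_)
    rw [norm_of_nonneg (hpos' _), mul_one_div]
    refine (hup _).trans ?_
    have := abs_le_norm_snocPt y s
    rw [norm_eq_abs s]
    gcongr
  have hp0 : Integrable fun y : EuclideanSpace ℝ (Fin d) => P (snocPt y 0) := by
    refine ((integrable_inv_one_add_norm_pow (V := EuclideanSpace ℝ (Fin d))
      (n := d + 2) (by omega)).const_mul 𝒞).mono'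
      (continuous_comp_snocPt_zero hc).aestronglyMeasurable
      (Filter.Eventually.of_forall fun y => ?_)
    rw [norm_of_nonneg (hpos' _), mul_one_div]
    exact (hup _).trans (div_one_add_norm_snocPt_le h𝒞0.le y 0 _)
  set S : ℝ := ∫ y : EuclideanSpace ℝ (Fin d), P (snocPt y 0) with hS
  have hSpos : 0 < S := by
    refine (integral_pos_iff_support_of_nonneg (fun y => hpos' _) hp0).2 ?_
    have : Function.support (fun y : EuclideanSpace ℝ (Fin d) => P (snocPt y 0)) = univ :=
      Set.eq_univ_of_forall fun y => (hpos _).ne'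
    rw [this]
    exact Measure.measure_univ_pos.2 (NeZero.ne volume)
  -- the radial integral bounds
  obtain ⟨K1, hK1, hT1⟩ := exists_setIntegral_compl_ball_le_inv
    (V := EuclideanSpace ℝ (Fin (d + 1))) (n := d + 2) (by omega)
  obtain ⟨K2, hK2, hT2⟩ := exists_setIntegral_ball_le_log
    (V := EuclideanSpace ℝ (Fin d)) (k := 2) (n := d + 2) (by omega)
  obtain ⟨K3, hK3, hT3⟩ := exists_setIntegral_ball_le_mul
    (V := EuclideanSpace ℝ (Fin d)) (k := 3) (n := d + 2) (by omega)
  obtain ⟨K4, hK4, hT4⟩ := exists_setIntegral_ball_le_mul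
    (V := EuclideanSpace ℝ (Fin d)) (k := 4) (n := d + 3) (by omega)
  obtain ⟨K6, hK6, hT6⟩ := exists_setIntegral_compl_ball_le_div
    (V := EuclideanSpace ℝ (Fin d)) (k := 1) (n := d + 2) (by omega)
  set K5 : ℝ := ∫ y : EuclideanSpace ℝ (Fin d), 1 / (1 + ‖y‖ ^ (d + 3)) with hK5def
  have hK5 : 0 ≤ K5 := integral_nonneg fun y => by positivity
  have hT5 : ∀ R, ∫ y in ball (0 : EuclideanSpace ℝ (Fin d)) R,
      ‖y‖ ^ 0 / (1 + ‖y‖ ^ (d + 3)) ≤ K5 := by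
    intro R
    simp only [pow_zero]
    exact setIntegral_le_integral (integrable_inv_one_add_norm_pow (by omega))
      (Filter.Eventually.of_forall fun y => by positivity)
  -- the Taylor expansion of the graph
  have hmem0 : ball (0 : EuclideanSpace ℝ (Fin d)) r ∈ nhds 0 := ball_mem_nhds 0 hr
  obtain ⟨K, hK, ρ₀, hρ₀, htaylor⟩ := exists_taylor_two (hγ3.contDiffAt hmem0) hγ0
    (by rw [← fderivWithin_of_mem_nhds hmem0]; exact hdγ0)
  set B := fderiv ℝ (fderiv ℝ γ) 0 with hB
  have hlap : ∑ i, B (EuclideanSpace.single i 1) (EuclideanSpace.single i 1) = lap0 γ := by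
    simp [lap0, iteratedFDeriv_two_apply, hB]
  set ρ : ℝ := min (min ρ₀ (r / 2)) 1 with hρdef
  have hρ : 0 < ρ := by positivity
  have hρρ₀ : ρ ≤ ρ₀ := (min_le_left _ _).trans (min_le_left _ _)
  have hρr : ρ ≤ r / 2 := (min_le_left _ _).trans (min_le_right _ _)
  have hρ1 : ρ ≤ 1 := min_le_right _ _
  set H : ℝ := lap0 γ / d with hH
  set M : ℝ := ‖B‖ + K with hM
  have hM0 : 0 < M := by positivity
  set vol1 : ℝ := volume.real (ball (0 : EuclideanSpace ℝ (Fin d)) 1) with hvol1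
  have hvol1pos : 0 < vol1 :=
    ENNReal.toReal_pos (measure_ball_pos _ _ one_pos).ne' measure_ball_lt_top.ne
  set c0 : ℝ := 𝒞⁻¹ / (1 + 2 ^ (d + 2)) * vol1 with hc0def
  have hc0 : 0 < c0 := by positivity
  set A1 : ℝ := 𝒞 * K1 / ρ with hA1
  set A3 : ℝ := (2 * A1 + 3 * 𝒞 * M * K2) / c0 with hA3
  set A4 : ℝ := A1 + 2 * 𝒞 * (4 * A3 ^ 2) * K5 + 2 * 𝒞 * M ^ 2 * K4 * ρ + 𝒞 * K * K3 * ρ with hA4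
  set A5 : ℝ := A4 + 𝒞 * K6 / ρ + |H| * (𝒞 * (1 / ρ) ^ d * vol1) with hA5
  have hA1pos : 0 < A1 := by positivity
  have hA3pos : 0 < A3 := by positivity
  have hA4pos : 0 < A4 := by positivity
  have hA5pos : 0 < A5 := by positivity
  refine ⟨A5 / S, by positivity, min (1 / (2 * exp 1)) (ρ ^ 2 / 2), by positivity, ?_⟩
  intro t ht v hv hu
  obtain ⟨⟨hs0, hs1⟩, hst⟩ := hσ t ⟨ht.1, ht.2.trans_le (min_le_left _ _)⟩
  set s : ℝ := σ t with hsdef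
  set L : ℝ := log (1 / s) with hL
  have hL2 : 1 / 2 < L := by
    have := log_lt_log hs0 hs1
    rw [log_exp] at this
    rw [hL, show log (1 / s) = -log s by rw [one_div, log_inv]]
    linarith
  have hs1' : s < 1 := hs1.trans_le (exp_le_one_iff.2 (by norm_num))
  have hsρ : s < ρ := by
    have h1 : t < ρ ^ 2 / 2 := ht.2.trans_le (min_le_right _ _)
    have h2 : s ^ 2 < ρ ^ 2 := by
      have h3 := mul_lt_mul_of_pos_left hL2 (pow_pos hs0 2)
      linarith
    exact (pow_lt_pow_iff_left₀ hs0.le hρ.le two_ne_zero).1 h2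
  have hsL : s * L ^ 2 ≤ 4 := log_inv_sq_mul_le hs0 hs1'
  set R : ℝ := ρ / s with hR
  have hRpos : 0 < R := by positivity
  have hR1 : 1 ≤ R := (one_le_div hs0).2 hsρ.le
  set α : ℝ := v * t / s with hα
  have hα1 : |α| ≤ 1 := by
    rw [hα, abs_div, abs_of_pos hs0]
    exact (div_le_one hs0).2 hv
  have hαv : α = v * (s * L) := by
    rw [hα, ← hst]
    field_simp
  set g : EuclideanSpace ℝ (Fin d) → ℝ := fun y => γ (-(s • y)) / s with hg
  have hgT := fun (y : EuclideanSpace ℝ (Fin d)) (hy : y ∈ ball 0 R) =>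
    rescaled_taylor hK.le hρ1 hs0 (fun x hx => htaylor x (ball_subset_ball hρρ₀ hx)) hy
  have hsmall : ∀ y : EuclideanSpace ℝ (Fin d), ‖y‖ ≤ R → ‖-(s • y)‖ ≤ ρ := by
    intro y hy
    rw [norm_neg, norm_smul, norm_of_nonneg hs0.le]
    rw [hR, le_div_iff₀ hs0] at hy
    linarith
  have hgc : ContinuousOn g (closedBall 0 R) := by
    refine ContinuousOn.div_const (hγ3.continuousOn.comp (by fun_prop) fun y hy => ?_) s
    have := hsmall y (by simpa using hy)
    rw [mem_ball_zero_iff]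
    linarith
  -- the zero condition
  have hJ : |∫ y in ball (0 : EuclideanSpace ℝ (Fin d)) R,
      ∫ z in (0 : ℝ)..(α - g y), P (snocPt y z)| ≤ A1 * s := by
    rw [uF12_eq_integral P E _ hs0] at hu
    have hxw : ∀ (y : EuclideanSpace ℝ (Fin d)) (z : ℝ),
        (v * t) • eN d - s • snocPt y z = snocPt (-(s • y)) (v * t - s * z) := by
      intro y z
      have h1 : (v * t) • eN d = snocPt (0 : EuclideanSpace ℝ (Fin d)) (v * t) := by
        have := snocPt_add_smul (0 : EuclideanSpace ℝ (Fin d)) 0 0 1 (v * t)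
        have h0 : snocPt (0 : EuclideanSpace ℝ (Fin d)) 0 = 0 := by
          rw [← norm_eq_zero, norm_snocPt_zero, norm_zero]
        rw [← eN_eq_snocPt, h0] at this
        simpa using this
      rw [h1, sub_eq_add_neg, ← neg_smul, snocPt_add_smul]
      simp [sub_eq_add_neg]
    have h := abs_setIntegral_slice_le hc hi hpos' heven hslice
      (τ := fun w => tauE E ((v * t) • eN d - s • w))
      ((measurable_tauE hEopen).comp (by fun_prop)) (fun w => abs_tauE_le_one _)
      (X := fun y => α - g y) (R := R) (continuousOn_const.sub hgc) ?_ hu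
    · refine h.trans ?_
      have h2 : ∫ w in (ball 0 R)ᶜ, P w ≤
          ∫ w in (ball (0 : EuclideanSpace ℝ (Fin (d + 1))) R)ᶜ,
            𝒞 * (1 / (1 + ‖w‖ ^ (d + 2))) := by
        refine setIntegral_mono hi.integrableOn
          ((integrable_inv_one_add_norm_pow (by omega)).const_mul 𝒞).integrableOn fun w => ?_
        rw [mul_one_div]
        exact hup w
      rw [integral_const_mul] at h2
      refine h2.trans ((mul_le_mul_of_nonneg_left (hT1 R hRpos) h𝒞0.le).trans (le_of_eq ?_))
      rw [hR, hA1]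
      field_simp
    · intro y z hyz hne
      have hy : ‖y‖ < R := (norm_le_norm_snocPt y z).trans_lt hyz
      have hz : |z| < R := (abs_le_norm_snocPt y z).trans_lt hyz
      have hyr : ‖-(s • y)‖ < r := by linarith [hsmall y hy.le]
      have hzr : |v * t - s * z| < r := by
        have h1 : |s * z| < ρ := by
          rw [abs_mul, abs_of_pos hs0]
          rw [hR, lt_div_iff₀ hs0] at hz
          linarith
        have h2 := abs_sub (v * t) (s * z)
        linarith
      have hX : s * (α - g y) = v * t - γ (-(s • y)) := by
        rw [hα, hg]
        field_simp
      simp only [hxw]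
      rcases lt_or_gt_of_ne hne with hlt | hgt
      · rw [if_pos hlt.le]
        refine tauE_of_mem ((hEQ _ _ hyr hzr).2 ?_)
        have := mul_lt_mul_of_pos_left hlt hs0
        linarith
      · rw [if_neg (not_le.2 hgt)]
        refine tauE_of_notMem_closure
          (snocPt_notMem_closure hγ3.continuousOn hEQ hyr hzr ?_)
        have := mul_lt_mul_of_pos_left hgt hs0
        linarith
  -- the a priori bound
  have hαA : |α| ≤ A3 * (s * L) := by
    have h := mul_abs_le_abs_setIntegral_slice_add hc h𝒞0 hlow hup heven hα1 hR1 hgc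
      fun y hy => (hgT y hy).1
    have hlog : log (1 + R) ≤ 3 * L := by
      have h1 : 1 + R ≤ 2 * (1 / s) := by
        have : R ≤ 1 / s := div_le_div_of_nonneg_right hρ1 hs0.le
        have : 1 ≤ 1 / s := (one_le_div hs0).2 hs1'.le
        linarith
      have h2 := log_le_log (by positivity) h1
      rw [log_mul (by norm_num) (by positivity)] at h2
      have h3 : log 2 ≤ 1 := by linarith [log_two_lt_d9]
      linarith
    have h2 : ∫ y in ball (0 : EuclideanSpace ℝ (Fin d)) R, ‖y‖ ^ 2 / (1 + ‖y‖ ^ (d + 2)) ≤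
        K2 * (3 * L) := (hT2 R hRpos).trans (by gcongr)
    have h3 : c0 * |α| ≤ A1 * s + 𝒞 * (M * s) * (K2 * (3 * L)) := by
      refine h.trans ?_
      gcongr
    have h4 : A1 * s ≤ 2 * A1 * (s * L) := by
      have : 0 < A1 * s := by positivity
      nlinarith
    rw [hA3, div_mul_eq_mul_div, le_div_iff₀ hc0]
    linarith
  have hα2 : α ^ 2 ≤ 4 * A3 ^ 2 * s := by
    have h1 : α ^ 2 ≤ (A3 * (s * L)) ^ 2 := by
      rw [← sq_abs]
      exact pow_le_pow_left₀ (abs_nonneg _) hαA 2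
    have h2 : (A3 * (s * L)) ^ 2 = A3 ^ 2 * s * (s * L ^ 2) := by ring
    rw [h2] at h1
    have h3 : A3 ^ 2 * s * (s * L ^ 2) ≤ A3 ^ 2 * s * 4 := by gcongr
    linarith
  -- the expansion
  have hexp := abs_mul_sub_le_abs_setIntegral_slice_add hP1 h𝒞0 hpos' hup hgrad (α := α)
    (N := M * s) (K := K * s ^ 2) (ν := s / 2) B hgc
    (fun y hy => (hgT y hy).1) (fun y hy => (hgT y hy).2)
  have hexp' : |α * (∫ y in ball (0 : EuclideanSpace ℝ (Fin d)) R, P (snocPt y 0)) -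
      s / 2 * ∫ y in ball (0 : EuclideanSpace ℝ (Fin d)) R, B y y * P (snocPt y 0)| ≤ A4 * s := by
    refine hexp.trans ?_
    have hRs : R * s = ρ := by rw [hR]; field_simp
    have i1 := mul_le_mul (mul_le_mul_of_nonneg_left hα2 (by positivity : 0 ≤ 2 * 𝒞)) (hT5 R)
      (integral_nonneg fun y => by positivity) (by positivity)
    have i2 := mul_le_mul_of_nonneg_left (hT4 R hRpos)
      (by positivity : 0 ≤ 2 * 𝒞 * (M * s) ^ 2)
    have i3 := mul_le_mul_of_nonneg_left (hT3 R hRpos) (by positivity : 0 ≤ 𝒞 * (K * s ^ 2))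
    have e2 : 2 * 𝒞 * (M * s) ^ 2 * (K4 * R) = 2 * 𝒞 * M ^ 2 * K4 * ρ * s := by
      rw [← hRs]; ring
    have e3 : 𝒞 * (K * s ^ 2) * (K3 * R) = 𝒞 * K * K3 * ρ * s := by rw [← hRs]; ring
    rw [e2] at i2
    rw [e3] at i3
    rw [hA4]
    linarith
  have htr : ∫ y in ball (0 : EuclideanSpace ℝ (Fin d)) R, B y y * P (snocPt y 0) =
      H * ∫ y in ball (0 : EuclideanSpace ℝ (Fin d)) R, ‖y‖ ^ 2 * P (snocPt y 0) := by
    have hcp := continuous_comp_snocPt_zero hc (d := d)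
    have hind : ∀ (f : EuclideanSpace ℝ (Fin d) → ℝ) (y : EuclideanSpace ℝ (Fin d)),
        f y * (ball (0 : EuclideanSpace ℝ (Fin d)) R).indicator (fun y => P (snocPt y 0)) y =
          (ball (0 : EuclideanSpace ℝ (Fin d)) R).indicator (fun y => f y * P (snocPt y 0)) y :=
      fun f y => (indicator_mul_right _ f _).symm
    have h := integral_bilin_mul_radial hd
      (f := (ball (0 : EuclideanSpace ℝ (Fin d)) R).indicator fun y => P (snocPt y 0)) ?_ ?_
      (hcp.aestronglyMeasurable.indicator measurableSet_ball) B
    · simp only [hind fun y => B y y, hind fun y => ‖y‖ ^ 2] at h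
      rw [hlap, integral_indicator measurableSet_ball, integral_indicator measurableSet_ball] at h
      exact h
    · intro x y hxy
      have : P (snocPt x 0) = P (snocPt y 0) :=
        hPrad _ _ (by rw [norm_snocPt_zero, norm_snocPt_zero, hxy])
      simp [indicator, hxy, this]
    · simp only [hind fun y => ‖y‖ ^ 2]
      refine (integrable_indicator_iff measurableSet_ball).2
        (Continuous.integrableOn_euclidean_ball ?_ R)
      exact (by fun_prop : Continuous fun y : EuclideanSpace ℝ (Fin d) => ‖y‖ ^ 2).mul hcp
  rw [htr] at hexp'
  have hJ2 := abs_setIntegral_ball_sub_le hc h𝒞0 hpos' hup hRpos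
    (div_le_div_of_nonneg_right hρ1 hs0.le : R ≤ 1 / s)
  have hRR : 1 / s / R = 1 / ρ := by rw [hR]; field_simp
  rw [hRR] at hJ2
  set JR := ∫ y in ball (0 : EuclideanSpace ℝ (Fin d)) R, ‖y‖ ^ 2 * P (snocPt y 0) with hJR
  set J1 := ∫ y in ball (0 : EuclideanSpace ℝ (Fin d)) (1 / s), ‖y‖ ^ 2 * P (snocPt y 0)
    with hJ1
  set SR := ∫ y in ball (0 : EuclideanSpace ℝ (Fin d)) R, P (snocPt y 0) with hSR
  have hSS : |S - SR| ≤ 𝒞 * K6 / ρ * s := by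
    have h1 := integral_add_compl (measurableSet_ball
      (x := (0 : EuclideanSpace ℝ (Fin d))) (ε := R)) hp0
    have h2 : S - SR = ∫ y in (ball (0 : EuclideanSpace ℝ (Fin d)) R)ᶜ, P (snocPt y 0) := by
      linarith
    have h3 : ∫ y in (ball (0 : EuclideanSpace ℝ (Fin d)) R)ᶜ, P (snocPt y 0) ≤
        ∫ y in (ball (0 : EuclideanSpace ℝ (Fin d)) R)ᶜ, 𝒞 * (1 / (1 + ‖y‖ ^ (d + 2))) := by
      refine setIntegral_mono hp0.integrableOn
        ((integrable_inv_one_add_norm_pow (by omega)).const_mul 𝒞).integrableOn fun y => ?_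
      simp only [mul_one_div]
      exact (hup _).trans (div_one_add_norm_snocPt_le h𝒞0.le y 0 _)
    rw [integral_const_mul] at h3
    rw [h2, abs_of_nonneg (integral_nonneg fun y => hpos' _)]
    refine h3.trans ((mul_le_mul_of_nonneg_left (hT6 R hRpos) h𝒞0.le).trans (le_of_eq ?_))
    rw [hR, pow_one]
    field_simp
  have hfinal : |α * S - s / 2 * (H * J1)| ≤ A5 * s := by
    have e : α * S - s / 2 * (H * J1) =
        (α * SR - s / 2 * (H * JR)) + α * (S - SR) + s / 2 * H * (JR - J1) := by ring
    have h1 : |α * (S - SR)| ≤ 𝒞 * K6 / ρ * s := by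
      rw [abs_mul]
      exact (mul_le_of_le_one_left (abs_nonneg _) hα1).trans hSS
    have h2 : |s / 2 * H * (JR - J1)| ≤ |H| * (𝒞 * (1 / ρ) ^ d * vol1) * s := by
      rw [abs_mul, abs_mul, abs_of_pos (by positivity : 0 < s / 2)]
      have h3 := mul_le_mul_of_nonneg_left hJ2 (by positivity : 0 ≤ s / 2 * |H|)
      refine h3.trans ?_
      have : 0 ≤ |H| * (𝒞 * (1 / ρ) ^ d * vol1) * s := by positivity
      linarith
    rw [e, hA5]
    refine (abs_add_three _ _ _).trans ?_
    linarith
  have hfin : v - J1 / (2 * L * S) * H = (α * S - s / 2 * (H * J1)) / (s * L * S) := by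
    rw [hαv]
    have : L ≠ 0 := by positivity
    field_simp
  rw [hfin, abs_div, abs_of_pos (by positivity : 0 < s * L * S), div_div,
    div_le_div_iff₀ (by positivity) (by positivity)]
  calc |α * S - s / 2 * (H * J1)| * (S * L) ≤ A5 * s * (S * L) := by gcongr
    _ = A5 * (s * L * S) := by ring
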